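/- Let m and n be integers with m ≥ 93 and n ≥ 31m. If D and D' are digraphs on n vertices with |A(D)| ≤ n − m and |A(D')| ≤ 2n − ⌊n/m⌋ − 1, then D and D' pack. -/

import Mathlib

/-- A digraph on `Fin n` given by its finite arc set: arcs are ordered pairs
of distinct vertices (irreflexivity). -/
def IsDigraph {n : ℕ} (A : Finset (Fin n × Fin n)) : Prop :=
  ∀ p ∈ A, p.1 ≠ p.2

/-- Two digraphs on `n` vertices pack if there is a bijection of the vertex
sets sending every arc of the first to a non-arc of the second. -/
def Packs {n : ℕ} (A A' : Finset (Fin n × Fin n)) : Prop :=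
  ∃ f : Fin n ≃ Fin n, ∀ p ∈ A, (f p.1, f p.2) ∉ A'

set_option linter.all false

namespace DP
open Finset

theorem avg_indep {α β : Type*} [Fintype α] [Fintype β] [DecidableEq α] [DecidableEq β] {k : ℕ}
    (i i' : Fin k ↪ α) (G : (Fin k ↪ β) → ℕ) :
    ∑ f : α ≃ β, G (i.trans f.toEmbedding) = ∑ f : α ≃ β, G (i'.trans f.toEmbedding) := by
  obtain ⟨g, hg⟩ : ∃ g : Equiv.Perm α, ∀ x, g (i x) = i' x := by
    exact Equiv.Perm.exists_extending_pair i i' i.injective i'.injective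
  refine (Fintype.sum_equiv (Equiv.equivCongr g (Equiv.refl β)) _ _ ?_)
  intro f
  congr 1
  ext x
  simp [← hg]

theorem avg {α β : Type*} [Fintype α] [Fintype β] [DecidableEq α] [DecidableEq β] {k : ℕ}
    (i : Fin k ↪ α) (G : (Fin k ↪ β) → ℕ) :
    (Fintype.card α).descFactorial k * ∑ f : α ≃ β, G (i.trans f.toEmbedding)
      = Fintype.card (α ≃ β) * ∑ j : Fin k ↪ β, G j := by
  have h1 : ∑ i' : Fin k ↪ α, ∑ f : α ≃ β, G (i'.trans f.toEmbedding)
      = (Fintype.card α).descFactorial k * ∑ f : α ≃ β, G (i.trans f.toEmbedding) := by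
    rw [Finset.sum_congr rfl (fun i' _ => avg_indep i' i G)]
    simp [Fintype.card_embedding_eq]
  rw [← h1, Finset.sum_comm]
  have h2 : ∀ f : α ≃ β, ∑ i' : Fin k ↪ α, G (i'.trans f.toEmbedding) = ∑ j : Fin k ↪ β, G j := by
    intro f
    refine Fintype.sum_equiv (Equiv.embeddingCongr (Equiv.refl _) f) _ _ ?_
    intro j
    congr 1
  simp [h2]

theorem avg2 {α β : Type*} [Fintype α] [Fintype β] [DecidableEq α] [DecidableEq β]
    (a b : α) (hab : a ≠ b) (g : β → β → ℕ) :
    (Fintype.card α).descFactorial 2 * ∑ f : α ≃ β, g (f a) (f b)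
      ≤ Fintype.card (α ≃ β) * ∑ y, ∑ z, g y z := by
  let i : Fin 2 ↪ α := ⟨![a, b], by
    intro x y; fin_cases x <;> fin_cases y <;> simp [hab, hab.symm]⟩
  have h := avg i (fun j => g (j 0) (j 1))
  have e : ∀ f : α ≃ β, g ((i.trans f.toEmbedding) 0) ((i.trans f.toEmbedding) 1) = g (f a) (f b) := by
    intro f; rfl
  simp only [e] at h
  rw [h]
  gcongr
  rw [← Fintype.sum_prod_type' (f := g)]
  have := Finset.sum_image (s := (univ : Finset (Fin 2 ↪ β))) (g := fun j => (j 0, j 1))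
    (f := fun p : β × β => g p.1 p.2) (by
      intro j _ j' _ hjj
      ext x
      simp at hjj
      fin_cases x <;> simp [hjj])
  rw [← this]
  exact Finset.sum_le_sum_of_subset (subset_univ _)

theorem avg3 {α β : Type*} [Fintype α] [Fintype β] [DecidableEq α] [DecidableEq β]
    (a b c : α) (hab : a ≠ b) (hac : a ≠ c) (hbc : b ≠ c)
    (g : β → β → β → ℕ) :
    (Fintype.card α).descFactorial 3 * ∑ f : α ≃ β, g (f a) (f b) (f c)
      ≤ Fintype.card (α ≃ β) * ∑ y, ∑ z, ∑ w, g y z w := by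
  let i : Fin 3 ↪ α := ⟨![a, b, c], by
    intro x y; fin_cases x <;> fin_cases y <;>
      simp [hab, hab.symm, hac, hac.symm, hbc, hbc.symm]⟩
  have h := avg i (fun j => g (j 0) (j 1) (j 2))
  have e : ∀ f : α ≃ β, g ((i.trans f.toEmbedding) 0) ((i.trans f.toEmbedding) 1)
      ((i.trans f.toEmbedding) 2) = g (f a) (f b) (f c) := by
    intro f; rfl
  simp only [e] at h
  rw [h]
  gcongr
  have e2 : ∑ y, ∑ z, ∑ w, g y z w = ∑ p : β × β × β, g p.1 p.2.1 p.2.2 := by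
    simp only [Fintype.sum_prod_type]
  rw [e2]
  have := Finset.sum_image (s := (univ : Finset (Fin 3 ↪ β))) (g := fun j => (j 0, j 1, j 2))
    (f := fun p : β × β × β => g p.1 p.2.1 p.2.2) (by
      intro j _ j' _ hjj
      ext x
      simp at hjj
      fin_cases x <;> simp [hjj])
  rw [← this]
  exact Finset.sum_le_sum_of_subset (subset_univ _)
end DP

namespace DP
open Finset

/-- indicator of an arc between `x` and `y`, in direction `b`. -/
def ar {γ : Type*} [DecidableEq γ] (A : Finset (γ × γ)) (b : Bool) (x y : γ) : ℕ :=
  if (cond b (x, y) (y, x)) ∈ A then 1 else 0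

/-- one-sided degree -/
def db {γ : Type*} [DecidableEq γ] [Fintype γ] (A : Finset (γ × γ)) (b : Bool) (x : γ) : ℕ :=
  ∑ y, ar A b x y

/-- total degree -/
def dt {γ : Type*} [DecidableEq γ] [Fintype γ] (A : Finset (γ × γ)) (x : γ) : ℕ :=
  ∑ b, db A b x

/-- irreflexive -/
def Irr {γ : Type*} (A : Finset (γ × γ)) : Prop := ∀ p ∈ A, p.1 ≠ p.2

section
variable {γ : Type*} [DecidableEq γ]

theorem ar_symm (A : Finset (γ × γ)) (b : Bool) (x y : γ) : ar A b x y = ar A (!b) y x := by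
  cases b <;> simp [ar]

theorem ar_le_one (A : Finset (γ × γ)) (b : Bool) (x y : γ) : ar A b x y ≤ 1 := by
  unfold ar; split_ifs <;> simp

theorem ar_self {A : Finset (γ × γ)} (h : Irr A) (b : Bool) (x : γ) : ar A b x x = 0 := by
  unfold ar
  rw [if_neg]
  intro hx
  cases b <;> exact h _ hx rfl

variable [Fintype γ]

theorem db_not (A : Finset (γ × γ)) (b : Bool) (x : γ) : db A (!b) x = ∑ y, ar A b y x := by
  unfold db
  exact sum_congr rfl (fun y _ => by rw [ar_symm A b y x])

theorem sum_ar (A : Finset (γ × γ)) (b : Bool) : ∑ x, ∑ y, ar A b x y = A.card := by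
  have h1 : ∑ x, ∑ y, ar A true x y = A.card := by
    rw [← Fintype.sum_prod_type']
    simp [ar]
  cases b
  · rw [sum_comm, ← h1]
    exact sum_congr rfl (fun x _ => sum_congr rfl (fun y _ => by simp [ar]))
  · exact h1

theorem sum_db (A : Finset (γ × γ)) (b : Bool) : ∑ x, db A b x = A.card := sum_ar A b

theorem db_le_dt (A : Finset (γ × γ)) (b : Bool) (x : γ) : db A b x ≤ dt A x := by
  unfold dt
  exact single_le_sum (f := fun b => db A b x) (fun _ _ => Nat.zero_le _) (mem_univ b)

theorem sum_dt (A : Finset (γ × γ)) : ∑ x, dt A x = 2 * A.card := by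
  unfold dt
  rw [sum_comm]
  simp [sum_db]

/-- low-degree endpoint -/
def lo (A : Finset (γ × γ)) (p : γ × γ) : γ := if dt A p.1 ≤ dt A p.2 then p.1 else p.2
/-- the other endpoint -/
def hi (A : Finset (γ × γ)) (p : γ × γ) : γ := if dt A p.1 ≤ dt A p.2 then p.2 else p.1
/-- direction -/
def dir (A : Finset (γ × γ)) (p : γ × γ) : Bool := decide (dt A p.1 ≤ dt A p.2)

theorem lo_hi (A : Finset (γ × γ)) (p : γ × γ) :
    (lo A p = p.1 ∧ hi A p = p.2 ∧ dir A p = true) ∨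
    (lo A p = p.2 ∧ hi A p = p.1 ∧ dir A p = false) := by
  unfold lo hi dir
  by_cases h : dt A p.1 ≤ dt A p.2 <;> simp [h]

end

section
variable {α β : Type*} [DecidableEq α] [DecidableEq β] [Fintype α] [Fintype β]

/-- conflicts -/
def Conf (A : Finset (α × α)) (A' : Finset (β × β)) (f : α ≃ β) : Finset (α × α) :=
  A.filter (fun p => (f p.1, f p.2) ∈ A')

/-- first penalty -/
def R1 (A : Finset (α × α)) (A' : Finset (β × β)) (c o : α) (f : α ≃ β) : ℕ :=
  ∑ x ∈ univ.erase o, ∑ b, ar A b c x * db A' (!b) (f x)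

/-- second penalty -/
def R2 (A : Finset (α × α)) (A' : Finset (β × β)) (c o : α) (f : α ≃ β) : ℕ :=
  ∑ x ∈ univ.erase o, ∑ b, ar A' b (f c) (f x) * db A (!b) x

/-- third penalty -/
def GG (A : Finset (α × α)) (A' : Finset (β × β)) (s : ℕ) (c : α) (f : α ≃ β) : ℕ :=
  dt A c + dt A' (f c) + 2 * s + 2

theorem sum_two {s : Finset α} (F F' : α → ℕ) (c w : α) (h : ∀ x, x ≠ c → x ≠ w → F' x = F x) :
    ∑ x ∈ s, F' x ≤ ∑ x ∈ s, F x + F' c + F' w := by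
  have : ∀ x ∈ s, F' x ≤ F x + (if x = c then F' c else 0) + (if x = w then F' w else 0) := by
    intro x _
    by_cases h1 : x = c
    · subst h1; simp; omega
    · by_cases h2 : x = w
      · subst h2; simp
      · simp [h1, h2, h x h1 h2]
  refine (sum_le_sum this).trans ?_
  rw [sum_add_distrib, sum_add_distrib]
  gcongr
  · rw [sum_ite_eq']; split_ifs <;> simp
  · rw [sum_ite_eq']; split_ifs <;> simp

theorem R1_swap (A : Finset (α × α)) (A' : Finset (β × β)) (c o c' w : α) (f : α ≃ β) :
    R1 A A' c o ((Equiv.swap c' w).trans f) ≤ R1 A A' c o f + dt A' (f w) + dt A' (f c') := by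
  unfold R1
  refine (sum_two (fun x => ∑ b, ar A b c x * db A' (!b) (f x)) _ c' w ?_).trans ?_
  · intro x h1 h2
    simp [Equiv.swap_apply_of_ne_of_ne h1 h2]
  · gcongr
    · simp only [Equiv.trans_apply, Equiv.swap_apply_left, dt, Fintype.sum_bool, Bool.not_true,
        Bool.not_false]
      have h1 := ar_le_one A true c c'
      have h2 := ar_le_one A false c c'
      nlinarith [Nat.mul_le_mul_right (db A' false (f w)) h1,
        Nat.mul_le_mul_right (db A' true (f w)) h2]
    · simp only [Equiv.trans_apply, Equiv.swap_apply_right, dt, Fintype.sum_bool, Bool.not_true,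
        Bool.not_false]
      have h1 := ar_le_one A true c w
      have h2 := ar_le_one A false c w
      nlinarith [Nat.mul_le_mul_right (db A' false (f c')) h1,
        Nat.mul_le_mul_right (db A' true (f c')) h2]

theorem R2_swap (A : Finset (α × α)) (A' : Finset (β × β)) (c o c' w : α) (f : α ≃ β)
    (h1 : c ≠ c') (h2 : c ≠ w) :
    R2 A A' c o ((Equiv.swap c' w).trans f) ≤ R2 A A' c o f + dt A c' + dt A w := by
  unfold R2
  refine (sum_two (fun x => ∑ b, ar A' b (f c) (f x) * db A (!b) x) _ c' w ?_).trans ?_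
  · intro x h3 h4
    simp [Equiv.swap_apply_of_ne_of_ne h1 h2, Equiv.swap_apply_of_ne_of_ne h3 h4]
  · have key : ∀ (y z : β) (x : α), ∑ b, ar A' b y z * db A (!b) x ≤ dt A x := by
      intro y z x
      simp only [dt, Fintype.sum_bool, Bool.not_true, Bool.not_false]
      have h1 := ar_le_one A' true y z
      have h2 := ar_le_one A' false y z
      nlinarith [Nat.mul_le_mul_right (db A false x) h1,
        Nat.mul_le_mul_right (db A true x) h2]
    gcongr
    · exact key _ _ _
    · exact key _ _ _

theorem exists_good (A : Finset (α × α)) (A' : Finset (β × β))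
    (s D0 Δ' h h' : ℕ)
    (hD : ∀ x, dt A x ≤ D0) (hΔ : ∀ y, dt A' y ≤ Δ')
    (hh : (univ.filter (fun x => s < dt A x)).card ≤ h)
    (hh' : (univ.filter (fun y => s < dt A' y)).card ≤ h')
    (f : α ≃ β) (c o : α) (Q : Finset (α × α))
    (hlt : R1 A A' c o f + R2 A A' c o f + (dt A c + 2 * Q.card) + (Δ' + D0 + h + h')
      < Fintype.card α) :
    ∃ w, (∀ b, ar A' b (f o) (f w) = 0) ∧ (∀ b, ar A b o w = 0) ∧
      (∀ x, x ≠ o → ∀ b, ar A b c x * ar A' (!b) (f x) (f w) = 0) ∧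
      (∀ x, x ≠ o → ∀ b, ar A' b (f c) (f x) * ar A (!b) x w = 0) ∧
      (∀ b, ar A b c w = 0) ∧ dt A w ≤ s ∧ dt A' (f w) ≤ s ∧ (∀ q ∈ Q, q.1 ≠ w ∧ q.2 ≠ w) := by
  let T : α → ℕ := fun w => ∑ b, ar A' b (f o) (f w) + ∑ b, ar A b o w
    + ∑ x ∈ univ.erase o, ∑ b, ar A b c x * ar A' (!b) (f x) (f w)
    + ∑ x ∈ univ.erase o, ∑ b, ar A' b (f c) (f x) * ar A (!b) x w
    + ∑ b, ar A b c w + (if s < dt A w then 1 else 0) + (if s < dt A' (f w) then 1 else 0)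
    + ∑ q ∈ Q, ((if q.1 = w then 1 else 0) + (if q.2 = w then 1 else 0))
  have hT : ∑ w, T w < Fintype.card α := by
    refine lt_of_le_of_lt ?_ hlt
    simp only [T, sum_add_distrib]
    have e1 : ∑ w, ∑ b, ar A' b (f o) (f w) ≤ Δ' := by
      rw [sum_comm]
      refine le_trans (le_of_eq ?_) (hΔ (f o))
      unfold dt db
      exact sum_congr rfl (fun b _ => Equiv.sum_comp f (fun y => ar A' b (f o) y))
    have e2 : ∑ w, ∑ b, ar A b o w ≤ D0 := by
      rw [sum_comm]; exact hD o
    have e3 : ∑ w, ∑ x ∈ univ.erase o, ∑ b, ar A b c x * ar A' (!b) (f x) (f w)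
        = R1 A A' c o f := by
      unfold R1
      rw [sum_comm]
      refine sum_congr rfl (fun x _ => ?_)
      rw [sum_comm]
      refine sum_congr rfl (fun b _ => ?_)
      rw [← mul_sum]
      congr 1
      exact Equiv.sum_comp f (fun y => ar A' (!b) (f x) y)
    have e4 : ∑ w, ∑ x ∈ univ.erase o, ∑ b, ar A' b (f c) (f x) * ar A (!b) x w
        = R2 A A' c o f := by
      unfold R2
      rw [sum_comm]
      refine sum_congr rfl (fun x _ => ?_)
      rw [sum_comm]
      refine sum_congr rfl (fun b _ => ?_)
      rw [← mul_sum]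
      rfl
    have e5 : ∑ w, ∑ b, ar A b c w = dt A c := by
      rw [sum_comm]; rfl
    have e6 : ∑ w, (if s < dt A w then 1 else 0) ≤ h := by
      simpa using hh
    have e7 : ∑ w, (if s < dt A' (f w) then 1 else 0) ≤ h' := by
      rw [Equiv.sum_comp f (fun y => if s < dt A' y then 1 else 0)]
      simpa using hh'
    have e8 : ∑ w, ∑ q ∈ Q, (if q.1 = w then 1 else 0) = Q.card := by
      rw [sum_comm]; simp
    have e9 : ∑ w, ∑ q ∈ Q, (if q.2 = w then 1 else 0) = Q.card := by
      rw [sum_comm]; simp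
    omega
  obtain ⟨w, hw⟩ : ∃ w, T w = 0 := by
    by_contra hcon
    push Not at hcon
    have : ∑ w : α, 1 ≤ ∑ w, T w := sum_le_sum (fun w _ => Nat.one_le_iff_ne_zero.2 (hcon w))
    simp at this
    omega
  refine ⟨w, ?_⟩
  simp only [T, Nat.add_eq_zero_iff, sum_eq_zero_iff, mem_univ, true_imp_iff, mem_erase, and_true,
    ite_eq_right_iff, one_ne_zero, imp_false, not_lt] at hw
  obtain ⟨⟨⟨⟨⟨⟨⟨h1, h2⟩, h3⟩, h4⟩, h5⟩, h6⟩, h7⟩, h8⟩ := hw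
  exact ⟨h1, h2, h3, h4, h5, h6, h7, h8⟩

theorem mem_iff_ar (A : Finset (α × α)) (p : α × α) : p ∈ A ↔ ar A true p.1 p.2 = 1 := by
  simp [ar]

theorem ar_lo_hi (A : Finset (α × α)) (A' : Finset (β × β)) (f : α ≃ β) (p : α × α) :
    ar A' true (f p.1) (f p.2) = ar A' (dir A p) (f (lo A p)) (f (hi A p)) := by
  rcases lo_hi A p with ⟨h1, h2, h3⟩ | ⟨h1, h2, h3⟩
  · rw [h1, h2, h3]
  · rw [h1, h2, h3, ar_symm]; rfl

theorem mem_Conf (A : Finset (α × α)) (A' : Finset (β × β)) (f : α ≃ β) (p : α × α) :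
    p ∈ Conf A A' f ↔ p ∈ A ∧ ar A' true (f p.1) (f p.2) = 1 := by
  simp [Conf, ar]

theorem fix (A : Finset (α × α)) (A' : Finset (β × β)) (hA : Irr A)
    (s D0 Δ' h h' : ℕ)
    (hD : ∀ x, dt A x ≤ D0) (hΔ : ∀ y, dt A' y ≤ Δ')
    (hh : (univ.filter (fun x => s < dt A x)).card ≤ h)
    (hh' : (univ.filter (fun y => s < dt A' y)).card ≤ h') :
    ∀ (k : ℕ) (f : α ≃ β), (Conf A A' f).card ≤ k →
    (∀ p ∈ Conf A A' f, R1 A A' (lo A p) (hi A p) f + R2 A A' (lo A p) (hi A p) f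
      + ∑ q ∈ Conf A A' f, GG A A' s (lo A q) f + (Δ' + D0 + h + h') < Fintype.card α) →
    ∃ g : α ≃ β, Conf A A' g = ∅ := by
  intro k
  induction k with
  | zero =>
    intro f hk _
    exact ⟨f, by simpa using hk⟩
  | succ k ih =>
    intro f hk hinv
    rcases (Conf A A' f).eq_empty_or_nonempty with he | ⟨p, hp⟩
    · exact ⟨f, he⟩
    have hip := hinv p hp
    set c := lo A p with hc
    set o := hi A p with ho
    have hpA : p ∈ A := ((mem_Conf A A' f p).1 hp).1
    have hpne : p.1 ≠ p.2 := hA p hpA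
    have hco : c ≠ o := by
      rcases lo_hi A p with ⟨h1, h2, h3⟩ | ⟨h1, h2, h3⟩
      · rw [hc, ho, h1, h2]; exact hpne
      · rw [hc, ho, h1, h2]; exact hpne.symm
    have hGsum : dt A c + 2 * (Conf A A' f).card ≤ ∑ q ∈ Conf A A' f, GG A A' s (lo A q) f := by
      have : dt A c ≤ ∑ q ∈ Conf A A' f, dt A (lo A q) :=
        single_le_sum (f := fun q => dt A (lo A q)) (fun _ _ => Nat.zero_le _) hp
      simp only [GG, sum_add_distrib, sum_const, smul_eq_mul]
      nlinarith [Nat.zero_le (∑ q ∈ Conf A A' f, dt A' (f (lo A q))),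
        Nat.zero_le ((Conf A A' f).card * (2 * s))]
    obtain ⟨w, w1, w2, w3, w4, w5, w6, w7, w8⟩ := exists_good A A' s D0 Δ' h h' hD hΔ hh hh' f c o
      (Conf A A' f) (by omega)
    have hcp : p.1 = c ∨ p.2 = c := by
      rcases lo_hi A p with ⟨h1, h2, h3⟩ | ⟨h1, h2, h3⟩
      · left; rw [hc, h1]
      · right; rw [hc, h1]
    have hop : p.1 = o ∨ p.2 = o := by
      rcases lo_hi A p with ⟨h1, h2, h3⟩ | ⟨h1, h2, h3⟩
      · right; rw [ho, h2]
      · left; rw [ho, h2]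
    have hcw : c ≠ w := by
      intro hcw
      rcases hcp with h | h
      · exact (w8 p hp).1 (h.trans hcw)
      · exact (w8 p hp).2 (h.trans hcw)
    have how : o ≠ w := by
      intro hcw
      rcases hop with h | h
      · exact (w8 p hp).1 (h.trans hcw)
      · exact (w8 p hp).2 (h.trans hcw)
    set g := (Equiv.swap c w).trans f with hg
    have gc : g c = f w := by simp [hg]
    have gw : g w = f c := by simp [hg]
    have gx : ∀ x, x ≠ c → x ≠ w → g x = f x := by
      intro x h1 h2; simp [hg, Equiv.swap_apply_of_ne_of_ne h1 h2]
    -- no conflicts at c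
    have noc : ∀ b x, ar A b c x = 1 → ar A' b (g c) (g x) = 1 → False := by
      intro b x h1 h2
      have hxc : x ≠ c := by
        rintro rfl
        rw [ar_self hA] at h1; omega
      have hxw : x ≠ w := by
        rintro rfl
        rw [w5 b] at h1; omega
      rw [gc, gx x hxc hxw, ar_symm] at h2
      by_cases hxo : x = o
      · rw [hxo, w1] at h2; omega
      · have := w3 x hxo b
        rw [h1, h2] at this; omega
    have now : ∀ b x, ar A b w x = 1 → ar A' b (g w) (g x) = 1 → False := by
      intro b x h1 h2
      have hxw : x ≠ w := by
        rintro rfl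
        rw [ar_self hA] at h1; omega
      have hxc : x ≠ c := by
        rintro rfl
        rw [ar_symm, w5] at h1; omega
      rw [gw, gx x hxc hxw] at h2
      rw [ar_symm] at h1
      by_cases hxo : x = o
      · rw [hxo, w2] at h1; omega
      · have := w4 x hxo b
        rw [h1, h2] at this; omega
    have hmemg : ∀ q ∈ Conf A A' g, q.1 ≠ c ∧ q.2 ≠ c ∧ q.1 ≠ w ∧ q.2 ≠ w := by
      intro q hq
      rw [mem_Conf, mem_iff_ar] at hq
      obtain ⟨h1, h2⟩ := hq
      refine ⟨?_, ?_, ?_, ?_⟩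
      · intro h; rw [h] at h1 h2; exact noc _ _ h1 h2
      · intro h; rw [h, ar_symm] at h1 h2; exact noc _ _ h1 h2
      · intro h; rw [h] at h1 h2; exact now _ _ h1 h2
      · intro h; rw [h, ar_symm] at h1 h2; exact now _ _ h1 h2
    have hsub : Conf A A' g ⊆ (Conf A A' f).erase p := by
      intro q hq
      obtain ⟨a1, a2, a3, a4⟩ := hmemg q hq
      rw [mem_erase]
      constructor
      · rintro rfl
        rcases hcp with h | h
        · exact a1 h
        · exact a2 h
      · rw [mem_Conf] at hq ⊢
        rw [gx _ a1 a3, gx _ a2 a4] at hq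
        exact hq
    have hlo : ∀ q ∈ Conf A A' g, lo A q ≠ c ∧ lo A q ≠ w := by
      intro q hq
      obtain ⟨a1, a2, a3, a4⟩ := hmemg q hq
      rcases lo_hi A q with ⟨h1, h2, h3⟩ | ⟨h1, h2, h3⟩ <;> rw [h1] <;> constructor <;> assumption
    have hGeq : ∑ q ∈ Conf A A' g, GG A A' s (lo A q) g = ∑ q ∈ Conf A A' g, GG A A' s (lo A q) f := by
      refine sum_congr rfl (fun q hq => ?_)
      unfold GG
      rw [gx _ (hlo q hq).1 (hlo q hq).2]
    have hGle : ∑ q ∈ Conf A A' g, GG A A' s (lo A q) g + GG A A' s c f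
        ≤ ∑ q ∈ Conf A A' f, GG A A' s (lo A q) f := by
      rw [hGeq, ← sum_erase_add _ _ hp]
      gcongr
    refine ih g ?_ ?_
    · have := card_le_card hsub
      rw [card_erase_of_mem hp] at this
      omega
    · intro q hq
      have hqf := hinv q (mem_of_mem_erase (hsub hq))
      have r1 := R1_swap A A' (lo A q) (hi A q) c w f
      have r2 := R2_swap A A' (lo A q) (hi A q) c w f (hlo q hq).1 (hlo q hq).2
      rw [← hg] at r1 r2
      have : GG A A' s c f = dt A c + dt A' (f c) + 2 * s + 2 := rfl
      omega
end
end DP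

namespace DP
open Finset
section
variable {α β : Type*} [DecidableEq α] [DecidableEq β] [Fintype α] [Fintype β]

theorem lo_ne_hi {A : Finset (α × α)} (hA : Irr A) {p : α × α} (hp : p ∈ A) : lo A p ≠ hi A p := by
  rcases lo_hi A p with ⟨h1, h2, h3⟩ | ⟨h1, h2, h3⟩
  · rw [h1, h2]; exact hA p hp
  · rw [h1, h2]; exact (hA p hp).symm

theorem sum_lo_le (A : Finset (α × α)) (s : ℕ) (hs : A.card ≤ s ^ 2) :
    ∑ p ∈ A, dt A (lo A p) ≤ 2 * A.card * s := by
  have h1 : (∑ p ∈ A, dt A (lo A p)) ^ 2 ≤ A.card * ∑ p ∈ A, (dt A (lo A p)) ^ 2 :=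
    sq_sum_le_card_mul_sum_sq
  have h2 : ∑ p ∈ A, (dt A (lo A p)) ^ 2 ≤ ∑ p ∈ A, dt A p.1 * dt A p.2 := by
    refine sum_le_sum (fun p _ => ?_)
    unfold lo
    split_ifs with h
    · rw [sq]; gcongr
    · rw [sq]; gcongr; omega
  have h3 : ∑ p ∈ A, dt A p.1 * dt A p.2 ≤ ∑ p : α × α, dt A p.1 * dt A p.2 :=
    sum_le_sum_of_subset (subset_univ _)
  have h4 : ∑ p : α × α, dt A p.1 * dt A p.2 = (2 * A.card) * (2 * A.card) := by
    rw [Fintype.sum_prod_type]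
    simp only [← mul_sum, ← sum_mul, sum_dt]
  have h5 : (∑ p ∈ A, dt A (lo A p)) ^ 2 ≤ (2 * A.card * s) ^ 2 := by
    calc _ ≤ A.card * ((2 * A.card) * (2 * A.card)) :=
          h1.trans (Nat.mul_le_mul_left _ ((h2.trans h3).trans h4.le))
      _ ≤ s ^ 2 * ((2 * A.card) * (2 * A.card)) := Nat.mul_le_mul_right _ hs
      _ = _ := by ring
  exact (Nat.pow_le_pow_iff_left (by norm_num)).1 h5

theorem markov (A : Finset (α × α)) (s : ℕ) :
    (univ.filter (fun x => s < dt A x)).card * s ≤ 2 * A.card := by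
  rw [← sum_dt A]
  calc _ = ∑ x ∈ univ.filter (fun x => s < dt A x), s := by simp
    _ ≤ ∑ x ∈ univ.filter (fun x => s < dt A x), dt A x :=
      sum_le_sum (fun x hx => (mem_filter.1 hx).2.le)
    _ ≤ _ := sum_le_sum_of_subset (subset_univ _)

theorem avgR1 {A : Finset (α × α)} {A' : Finset (β × β)} (hA : Irr A)
    (p : α × α) (hp : p ∈ A) :
    (Fintype.card α).descFactorial 3 *
      ∑ f : α ≃ β, ar A' (dir A p) (f (lo A p)) (f (hi A p)) * R1 A A' (lo A p) (hi A p) f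
    ≤ Fintype.card (α ≃ β) * (dt A (lo A p) * A'.card ^ 2) := by
  have hne := lo_ne_hi hA hp
  generalize lo A p = c at *
  generalize hi A p = o at *
  generalize dir A p = d at *
  have e1 : ∑ f : α ≃ β, ar A' d (f c) (f o) * R1 A A' c o f
      = ∑ x ∈ univ.erase o, ∑ b, ar A b c x *
        ∑ f : α ≃ β, ar A' d (f c) (f o) * db A' (!b) (f x) := by
    unfold R1
    simp only [mul_sum]
    rw [sum_comm]
    refine sum_congr rfl (fun x _ => ?_)
    rw [sum_comm]
    refine sum_congr rfl (fun b _ => sum_congr rfl (fun f _ => by ring))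
  have e2 : ∀ x ∈ univ.erase o, ∀ b, (Fintype.card α).descFactorial 3 * (ar A b c x *
        ∑ f : α ≃ β, ar A' d (f c) (f o) * db A' (!b) (f x))
      ≤ ar A b c x * (Fintype.card (α ≃ β) * A'.card ^ 2) := by
    intro x hx b
    by_cases hxc : x = c
    · rw [hxc, ar_self hA]; simp
    have hxo := (mem_erase.1 hx).1
    have := avg3 (β := β) c o x hne (Ne.symm hxc) (Ne.symm hxo)
      (fun y z w => ar A' d y z * db A' (!b) w)
    simp only [← mul_sum, ← sum_mul, sum_db, sum_ar] at this
    calc _ = ar A b c x * ((Fintype.card α).descFactorial 3 *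
        ∑ f : α ≃ β, ar A' d (f c) (f o) * db A' (!b) (f x)) := by ring
      _ ≤ _ := by rw [sq]; gcongr
  rw [e1, mul_sum]
  calc _ ≤ ∑ x ∈ univ.erase o, ∑ b, ar A b c x * (Fintype.card (α ≃ β) * A'.card ^ 2) := by
        refine sum_le_sum (fun x hx => ?_)
        rw [mul_sum]
        exact sum_le_sum (fun b _ => e2 x hx b)
    _ ≤ ∑ x, ∑ b, ar A b c x * (Fintype.card (α ≃ β) * A'.card ^ 2) :=
        sum_le_sum_of_subset (subset_univ _)
    _ = dt A c * (Fintype.card (α ≃ β) * A'.card ^ 2) := by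
        simp only [← sum_mul]
        congr 1
        rw [sum_comm]; rfl
    _ = _ := by ring

theorem sum_db_dt {A' : Finset (β × β)} {Δ' : ℕ} (hΔ : ∀ y, dt A' y ≤ Δ') (d : Bool) :
    ∑ y, db A' d y * dt A' y ≤ A'.card * Δ' := by
  rw [← sum_db A' d, sum_mul]
  exact sum_le_sum (fun y _ => Nat.mul_le_mul_left _ (hΔ y))

theorem avgR2 {A : Finset (α × α)} {A' : Finset (β × β)} (hA : Irr A) (hA' : Irr A')
    {Δ' : ℕ} (hΔ : ∀ y, dt A' y ≤ Δ') (p : α × α) (hp : p ∈ A) :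
    (Fintype.card α).descFactorial 3 *
      ∑ f : α ≃ β, ar A' (dir A p) (f (lo A p)) (f (hi A p)) * R2 A A' (lo A p) (hi A p) f
    ≤ Fintype.card (α ≃ β) * (A.card * (A'.card * Δ')) := by
  have hne := lo_ne_hi hA hp
  generalize lo A p = c at *
  generalize hi A p = o at *
  generalize dir A p = d at *
  have e1 : ∑ f : α ≃ β, ar A' d (f c) (f o) * R2 A A' c o f
      = ∑ x ∈ univ.erase o, ∑ b, db A (!b) x *
        ∑ f : α ≃ β, ar A' d (f c) (f o) * ar A' b (f c) (f x) := by
    unfold R2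
    simp only [mul_sum]
    rw [sum_comm]
    refine sum_congr rfl (fun x _ => ?_)
    rw [sum_comm]
    refine sum_congr rfl (fun b _ => sum_congr rfl (fun f _ => by ring))
  have e2 : ∀ x ∈ univ.erase o, ∀ b, (Fintype.card α).descFactorial 3 * (db A (!b) x *
        ∑ f : α ≃ β, ar A' d (f c) (f o) * ar A' b (f c) (f x))
      ≤ db A (!b) x * (Fintype.card (α ≃ β) * ∑ y, db A' d y * db A' b y) := by
    intro x hx b
    by_cases hxc : x = c
    · rw [hxc]; simp [ar_self hA']
    have hxo := (mem_erase.1 hx).1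
    have := avg3 (β := β) c o x hne (Ne.symm hxc) (Ne.symm hxo)
      (fun y z w => ar A' d y z * ar A' b y w)
    simp only [← mul_sum, ← sum_mul] at this
    calc _ = db A (!b) x * ((Fintype.card α).descFactorial 3 *
        ∑ f : α ≃ β, ar A' d (f c) (f o) * ar A' b (f c) (f x)) := by ring
      _ ≤ _ := Nat.mul_le_mul_left _ this
  rw [e1, mul_sum]
  calc _ ≤ ∑ x ∈ univ.erase o, ∑ b, db A (!b) x *
          (Fintype.card (α ≃ β) * ∑ y, db A' d y * db A' b y) := by
        refine sum_le_sum (fun x hx => ?_)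
        rw [mul_sum]
        exact sum_le_sum (fun b _ => e2 x hx b)
    _ ≤ ∑ x, ∑ b, db A (!b) x *
          (Fintype.card (α ≃ β) * ∑ y, db A' d y * db A' b y) :=
        sum_le_sum_of_subset (subset_univ _)
    _ = Fintype.card (α ≃ β) * (A.card * ∑ y, db A' d y * dt A' y) := by
        rw [sum_comm]
        simp only [← sum_mul, sum_db]
        simp only [dt, mul_sum]
        rw [sum_comm]
        exact sum_congr rfl (fun x _ => sum_congr rfl (fun b _ => by ring))
    _ ≤ _ := by gcongr; exact sum_db_dt hΔ d

theorem avgG {A : Finset (α × α)} {A' : Finset (β × β)} (hA : Irr A) (s : ℕ)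
    {Δ' : ℕ} (hΔ : ∀ y, dt A' y ≤ Δ') (p : α × α) (hp : p ∈ A) :
    (Fintype.card α).descFactorial 2 *
      ∑ f : α ≃ β, ar A' (dir A p) (f (lo A p)) (f (hi A p)) * GG A A' s (lo A p) f
    ≤ Fintype.card (α ≃ β) * (dt A (lo A p) * A'.card + A'.card * Δ' + A'.card * (2 * s + 2)) := by
  have hne := lo_ne_hi hA hp
  generalize lo A p = c at *
  generalize hi A p = o at *
  generalize dir A p = d at *
  refine (avg2 (β := β) c o hne (fun y z => ar A' d y z * (dt A c + dt A' y + 2 * s + 2))).trans ?_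
  gcongr
  simp only [← sum_mul]
  calc _ = ∑ y, (db A' d y * (dt A c) + db A' d y * dt A' y + db A' d y * (2 * s + 2)) := by
        refine sum_congr rfl (fun y _ => ?_)
        rw [db]; ring
    _ ≤ _ := by
        rw [sum_add_distrib, sum_add_distrib, ← sum_mul, ← sum_mul, sum_db]
        have := sum_db_dt hΔ d
        nlinarith

theorem lemmaA0 {A : Finset (α × α)} {A' : Finset (β × β)} (hA : Irr A) (hA' : Irr A')
    (hc : Fintype.card α = Fintype.card β)
    (s D0 Δ' h h' S : ℕ)
    (hD : ∀ x, dt A x ≤ D0) (hΔ : ∀ y, dt A' y ≤ Δ')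
    (hh : (univ.filter (fun x => s < dt A x)).card ≤ h)
    (hh' : (univ.filter (fun y => s < dt A' y)).card ≤ h')
    (hS : ∑ p ∈ A, dt A (lo A p) ≤ S)
    (hnum : S * A'.card ^ 2 + A.card * (A.card * (A'.card * Δ')) + (Fintype.card α - 2) *
      (S * A'.card + A.card * (A'.card * Δ') + A.card * (A'.card * (2 * s + 2)))
      + (Δ' + D0 + h + h') * (Fintype.card α).descFactorial 3
      < Fintype.card α * (Fintype.card α).descFactorial 3) :
    ∃ g : α ≃ β, ∀ p ∈ A, (g p.1, g p.2) ∉ A' := by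
  set N := Fintype.card α with hN
  set F := Fintype.card (α ≃ β) with hF
  let Om : (α ≃ β) → ℕ := fun f => ∑ p ∈ A, ar A' (dir A p) (f (lo A p)) (f (hi A p)) *
    (R1 A A' (lo A p) (hi A p) f + R2 A A' (lo A p) (hi A p) f + GG A A' s (lo A p) f)
  have hFpos : 0 < F := by
    rw [hF, Fintype.card_pos_iff]
    exact ⟨Fintype.equivOfCardEq hc⟩
  have hd : N.descFactorial 3 = (N - 2) * N.descFactorial 2 := by
    rw [Nat.descFactorial_succ]
  have key : N.descFactorial 3 * ∑ f, Om f ≤ F * (S * A'.card ^ 2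
      + A.card * (A.card * (A'.card * Δ')) + (N - 2) *
      (S * A'.card + A.card * (A'.card * Δ') + A.card * (A'.card * (2 * s + 2)))) := by
    simp only [Om]
    rw [sum_comm, mul_sum]
    have : ∀ p ∈ A, N.descFactorial 3 * ∑ f : α ≃ β, ar A' (dir A p) (f (lo A p)) (f (hi A p)) *
        (R1 A A' (lo A p) (hi A p) f + R2 A A' (lo A p) (hi A p) f + GG A A' s (lo A p) f)
        ≤ F * (dt A (lo A p) * A'.card ^ 2 + A.card * (A'.card * Δ') +
        (N - 2) * (dt A (lo A p) * A'.card + A'.card * Δ' + A'.card * (2 * s + 2))) := by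
      intro p hp
      have a1 := avgR1 (A' := A') hA p hp
      have a2 := avgR2 hA hA' hΔ p hp
      have a3 := Nat.mul_le_mul_left (N - 2) (avgG hA s hΔ p hp)
      rw [← mul_assoc (N - 2), ← hN, ← hd] at a3
      simp only [mul_add, sum_add_distrib] at a1 a2 a3 ⊢
      rw [← hF] at a1 a2 a3
      linarith
    refine (sum_le_sum this).trans ?_
    rw [← mul_sum]
    gcongr
    calc _ = (∑ p ∈ A, dt A (lo A p)) * A'.card ^ 2 + A.card * (A.card * (A'.card * Δ')) +
          (N - 2) * ((∑ p ∈ A, dt A (lo A p)) * A'.card + A.card * (A'.card * Δ')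
          + A.card * (A'.card * (2 * s + 2))) := by
          rw [sum_add_distrib, sum_add_distrib, sum_const, ← mul_sum A _ (N - 2), sum_add_distrib,
            sum_add_distrib, sum_const, sum_const, ← sum_mul, ← sum_mul]
          simp only [smul_eq_mul]
      _ ≤ _ := by gcongr
  obtain ⟨f, hf⟩ : ∃ f, Om f + (Δ' + D0 + h + h') < N := by
    by_contra hcon
    push Not at hcon
    have h1 : ∑ f : α ≃ β, N ≤ ∑ f, (Om f + (Δ' + D0 + h + h')) := sum_le_sum (fun f _ => hcon f)
    simp only [sum_add_distrib, sum_const, smul_eq_mul, card_univ] at h1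
    rw [← hF] at h1
    have h2 := Nat.mul_le_mul_left (N.descFactorial 3) h1
    have h3 := (Nat.mul_lt_mul_left hFpos).2 hnum
    nlinarith
  obtain ⟨g, hg⟩ := fix A A' hA s D0 Δ' h h' hD hΔ hh hh' _ f le_rfl (by
    intro p hp
    refine lt_of_le_of_lt ?_ hf
    gcongr
    have hOm : Om f = ∑ p ∈ Conf A A' f,
        (R1 A A' (lo A p) (hi A p) f + R2 A A' (lo A p) (hi A p) f + GG A A' s (lo A p) f) := by
      simp only [Om, Conf, sum_filter]
      refine sum_congr rfl (fun q _ => ?_)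
      rw [← ar_lo_hi]
      unfold ar
      split_ifs <;> simp_all
    rw [hOm, sum_add_distrib]
    gcongr
    exact single_le_sum (f := fun p => R1 A A' (lo A p) (hi A p) f + R2 A A' (lo A p) (hi A p) f)
      (fun _ _ => Nat.zero_le _) hp)
  refine ⟨g, fun p hp hpA => ?_⟩
  have : p ∈ Conf A A' g := by simp [Conf, hp, hpA]
  rw [hg] at this
  simp at this

/-- first moment -/
theorem layer0T {A : Finset (α × α)} {A' : Finset (β × β)} (hA : Irr A)
    (hc : Fintype.card α = Fintype.card β)
    (hnum : A.card * A'.card < Fintype.card α * (Fintype.card α - 1)) :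
    ∃ g : α ≃ β, ∀ p ∈ A, (g p.1, g p.2) ∉ A' := by
  by_contra hcon
  push Not at hcon
  have hFpos : 0 < Fintype.card (α ≃ β) := by
    rw [Fintype.card_pos_iff]
    exact ⟨Fintype.equivOfCardEq hc⟩
  have h1 : ∀ f : α ≃ β, 1 ≤ ∑ p ∈ A, ar A' true (f p.1) (f p.2) := by
    intro f
    obtain ⟨p, hp, hp'⟩ := hcon f
    refine le_trans ?_ (single_le_sum (f := fun p => ar A' true (f p.1) (f p.2))
      (fun _ _ => Nat.zero_le _) hp)
    simp [ar, hp']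
  have h2 : Fintype.card (α ≃ β) ≤ ∑ f : α ≃ β, ∑ p ∈ A, ar A' true (f p.1) (f p.2) := by
    have := sum_le_sum (s := univ) (fun f _ => h1 f)
    simpa using this
  have h3 : (Fintype.card α).descFactorial 2 * ∑ f : α ≃ β, ∑ p ∈ A, ar A' true (f p.1) (f p.2)
      ≤ Fintype.card (α ≃ β) * (A.card * A'.card) := by
    rw [sum_comm, mul_sum]
    calc _ ≤ ∑ p ∈ A, Fintype.card (α ≃ β) * A'.card := by
          refine sum_le_sum (fun p hp => ?_)
          have := avg2 (β := β) p.1 p.2 (hA p hp) (fun y z => ar A' true y z)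
          rwa [sum_ar] at this
      _ = _ := by simp; ring
  have h4 : (Fintype.card α).descFactorial 2 = Fintype.card α * (Fintype.card α - 1) := by
    simp [Nat.descFactorial_succ]; ring
  have h5 := (Nat.mul_lt_mul_left hFpos).2 hnum
  have h6 := Nat.mul_le_mul_left ((Fintype.card α).descFactorial 2) h2
  rw [h4] at h3 h6
  nlinarith
end
end DP

namespace DP
open Finset
section
variable {V : Type*} [DecidableEq V] [Fintype V]

/-- restriction of an arc set -/
def res (A : Finset (V × V)) (X : Finset V) : Finset (V × V) :=
  A.filter (fun p => p.1 ∈ X ∧ p.2 ∈ X)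

/-- packing of the part on `X` into the part on `Y` -/
def PackOn (A A' : Finset (V × V)) (X Y : Finset V) : Prop :=
  ∃ f : V → V, (∀ x ∈ X, f x ∈ Y) ∧ Set.InjOn f X ∧
    ∀ x ∈ X, ∀ y ∈ X, (x, y) ∈ A → (f x, f y) ∉ A'

theorem mem_res {A : Finset (V × V)} {X : Finset V} {x y : V} :
    (x, y) ∈ res A X ↔ (x, y) ∈ A ∧ x ∈ X ∧ y ∈ X := by
  simp [res]

theorem irr_res {A : Finset (V × V)} (h : Irr A) (X : Finset V) : Irr (res A X) := by
  intro p hp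
  exact h p (mem_filter.1 hp).1

theorem res_mono (A : Finset (V × V)) {X Y : Finset V} (h : X ⊆ Y) : res A X ⊆ res A Y := by
  intro p hp
  rw [res, mem_filter] at hp ⊢
  exact ⟨hp.1, h hp.2.1, h hp.2.2⟩

theorem res_res (A : Finset (V × V)) {X Y : Finset V} (h : X ⊆ Y) : res (res A Y) X = res A X := by
  ext p
  simp only [res, mem_filter]
  constructor
  · rintro ⟨⟨a, b⟩, c⟩; exact ⟨a, c⟩
  · rintro ⟨a, c⟩; exact ⟨⟨a, h c.1, h c.2⟩, c⟩

theorem ar_res (A : Finset (V × V)) (X : Finset V) (b : Bool) (x y : V) :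
    ar (res A X) b x y = if x ∈ X ∧ y ∈ X then ar A b x y else 0 := by
  cases b
  · simp only [ar, cond_false, mem_res]; split_ifs <;> simp_all
  · simp only [ar, cond_true, mem_res]; split_ifs <;> simp_all

theorem dt_res_of_notMem (A : Finset (V × V)) {X : Finset V} {x : V} (h : x ∉ X) :
    dt (res A X) x = 0 := by
  simp [dt, db, ar_res, h]

theorem ar_mono {A B : Finset (V × V)} (h : A ⊆ B) (b : Bool) (x y : V) : ar A b x y ≤ ar B b x y := by
  unfold ar
  split_ifs with h1 h2
  · exact le_rfl
  · exact absurd (h h1) h2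
  · exact Nat.zero_le _
  · exact le_rfl

theorem dt_mono {A B : Finset (V × V)} (h : A ⊆ B) (x : V) : dt A x ≤ dt B x :=
  sum_le_sum (fun b _ => sum_le_sum (fun y _ => ar_mono h b x y))

/-- arcs on the subtype -/
def sub (A : Finset (V × V)) (X : Finset V) : Finset (X × X) :=
  univ.filter (fun p => (p.1.1, p.2.1) ∈ A)

theorem ar_sub (A : Finset (V × V)) (X : Finset V) (b : Bool) (x y : X) :
    ar (sub A X) b x y = ar (res A X) b x.1 y.1 := by
  rw [ar_res]
  cases b <;> simp [ar, sub]

theorem db_sub (A : Finset (V × V)) (X : Finset V) (b : Bool) (x : X) :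
    db (sub A X) b x = db (res A X) b x.1 := by
  unfold db
  simp only [ar_sub]
  rw [Finset.sum_coe_sort X (fun y => ar (res A X) b x.1 y)]
  refine sum_subset (subset_univ _) ?_
  intro y _ hy
  simp [ar_res, hy]

theorem dt_sub (A : Finset (V × V)) (X : Finset V) (x : X) :
    dt (sub A X) x = dt (res A X) x.1 := by
  unfold dt; simp only [db_sub]

theorem card_sub (A : Finset (V × V)) (X : Finset V) : (sub A X).card = (res A X).card := by
  rw [← sum_db (sub A X) true, ← sum_db (res A X) true]
  simp only [db_sub]
  rw [Finset.sum_coe_sort X (fun y => db (res A X) true y)]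
  refine sum_subset (subset_univ _) ?_
  intro y _ hy
  simp [db, ar_res, hy]

theorem irr_sub {A : Finset (V × V)} (h : Irr A) (X : Finset V) : Irr (sub A X) := by
  intro p hp hpp
  simp only [sub, mem_filter, mem_univ, true_and] at hp
  exact h _ hp (by simp [hpp])

theorem packOn_of_sub {A A' : Finset (V × V)} {X Y : Finset V}
    (h : ∃ g : X ≃ Y, ∀ p ∈ sub A X, (g p.1, g p.2) ∉ sub A' Y) : PackOn A A' X Y := by
  obtain ⟨g, hg⟩ := h
  refine ⟨fun x => if h : x ∈ X then (g ⟨x, h⟩).1 else x, ?_, ?_, ?_⟩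
  · intro x hx; simp [hx]
  · intro x hx y hy hxy
    simp only [mem_coe] at hx hy
    simp only [hx, hy, dif_pos] at hxy
    have := g.injective (Subtype.ext hxy)
    simpa using this
  · intro x hx y hy hxy
    simp only [hx, hy, dif_pos]
    have := hg (⟨x, hx⟩, ⟨y, hy⟩) (by simp [sub, hxy])
    simpa [sub] using this

theorem PackOn.mono {A A' : Finset (V × V)} {X X' Y Y' : Finset V} (h : PackOn A A' X' Y')
    (hX : X ⊆ X') (hY : Y' ⊆ Y) : PackOn A A' X Y := by
  obtain ⟨f, h1, h2, h3⟩ := h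
  exact ⟨f, fun x hx => hY (h1 x (hX hx)), h2.mono (by exact_mod_cast hX),
    fun x hx y hy => h3 x (hX hx) y (hX hy)⟩

theorem packOn_res {A A' : Finset (V × V)} {X Y : Finset V} (h : PackOn (res A X) A' X Y) :
    PackOn A A' X Y := by
  obtain ⟨f, h1, h2, h3⟩ := h
  exact ⟨f, h1, h2, fun x hx y hy hxy => h3 x hx y hy (mem_res.2 ⟨hxy, hx, hy⟩)⟩

theorem exists_inj {X Y : Finset V} (h : X.card ≤ Y.card) :
    ∃ f : V → V, (∀ x ∈ X, f x ∈ Y) ∧ Set.InjOn f X := by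
  rcases X.eq_empty_or_nonempty with rfl | ⟨x0, hx0⟩
  · exact ⟨id, by simp, by simp⟩
  have : Nonempty V := ⟨x0⟩
  obtain ⟨f, h1, h2⟩ := (Set.toFinite (X : Set V)).exists_injOn_of_encard_le (t := (Y : Set V))
    (by simpa [Set.encard_coe_eq_coe_finsetCard] using h)
  exact ⟨f, fun x hx => by simpa using h1 hx, h2⟩

theorem layer0 {A A' : Finset (V × V)} (hA : Irr A) {X Y : Finset V} (hc : X.card ≤ Y.card)
    (hnum : (res A X).card * (res A' Y).card < Y.card * (Y.card - 1) ∨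
      (res A X).card * (res A' Y).card = 0) : PackOn A A' X Y := by
  rcases hnum with hnum | hnum
  · obtain ⟨X', hX', -, hcard⟩ := exists_subsuperset_card_eq (subset_univ X) hc
      (by simpa using card_le_univ Y)
    refine packOn_res (PackOn.mono ?_ hX' (Subset.refl Y))
    apply packOn_of_sub
    apply layer0T (irr_sub (irr_res hA X) X')
    · simp [hcard]
    · rw [card_sub, card_sub]
      simp only [Fintype.card_coe, hcard]
      refine lt_of_le_of_lt ?_ hnum
      gcongr
      exact filter_subset _ _
  · obtain ⟨f, h1, h2⟩ := exists_inj hc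
    refine ⟨f, h1, h2, fun x hx y hy hxy hxy' => ?_⟩
    rcases Nat.mul_eq_zero.1 hnum with h | h
    · rw [card_eq_zero] at h
      have : (x, y) ∈ res A X := mem_res.2 ⟨hxy, hx, hy⟩
      rw [h] at this; simp at this
    · rw [card_eq_zero] at h
      have : (f x, f y) ∈ res A' Y := mem_res.2 ⟨hxy', h1 x hx, h1 y hy⟩
      rw [h] at this; simp at this

/-- closed subsets -/
def Closed (A : Finset (V × V)) (X K : Finset V) : Prop :=
  K ⊆ X ∧ ∀ x ∈ X, ∀ y ∈ X, (x, y) ∈ A → (x ∈ K ↔ y ∈ K)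

theorem combine_gen {A A' : Finset (V × V)} {X Y K Z : Finset V} (f : V → V)
    (f1 : ∀ x ∈ K, f x ∈ Z) (f2 : Set.InjOn f K)
    (f3 : ∀ x ∈ K, ∀ y ∈ K, (x, y) ∈ A → (f x, f y) ∉ A') (hZ : Z ⊆ Y)
    (hcr : ∀ x ∈ K, ∀ y ∈ X \ K, ∀ z ∈ Y \ Z, ((x, y) ∈ A → (f x, z) ∉ A') ∧
      ((y, x) ∈ A → (z, f x) ∉ A'))
    (h2 : PackOn A A' (X \ K) (Y \ Z)) : PackOn A A' X Y := by
  obtain ⟨g, g1, g2, g3⟩ := h2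
  refine ⟨fun x => if x ∈ K then f x else g x, ?_, ?_, ?_⟩
  · intro x hx
    by_cases h : x ∈ K
    · simp only [h, if_true]; exact hZ (f1 x h)
    · simp only [h, if_false]; exact (mem_sdiff.1 (g1 x (mem_sdiff.2 ⟨hx, h⟩))).1
  · intro x hx y hy hxy
    simp only [mem_coe] at hx hy
    by_cases h : x ∈ K <;> by_cases h' : y ∈ K <;> simp only [h, h', if_true, if_false] at hxy
    · exact f2 h h' hxy
    · exact absurd (hxy ▸ f1 x h) (mem_sdiff.1 (g1 y (mem_sdiff.2 ⟨hy, h'⟩))).2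
    · exact absurd (hxy ▸ f1 y h') (mem_sdiff.1 (g1 x (mem_sdiff.2 ⟨hx, h⟩))).2
    · exact g2 (by simp [hx, h]) (by simp [hy, h']) hxy
  · intro x hx y hy hxy
    by_cases h : x ∈ K <;> by_cases h' : y ∈ K <;> simp only [h, h', if_true, if_false]
    · exact f3 x h y h' hxy
    · have hy' := mem_sdiff.2 ⟨hy, h'⟩
      exact (hcr x h y hy' _ (g1 y hy')).1 hxy
    · have hx' := mem_sdiff.2 ⟨hx, h⟩
      exact (hcr y h' x hx' _ (g1 x hx')).2 hxy
    · exact g3 x (mem_sdiff.2 ⟨hx, h⟩) y (mem_sdiff.2 ⟨hy, h'⟩) hxy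

theorem combine {A A' : Finset (V × V)} {X Y K Z : Finset V} (hK : Closed A X K) (hZ : Z ⊆ Y)
    (h1 : PackOn A A' K Z) (h2 : PackOn A A' (X \ K) (Y \ Z)) : PackOn A A' X Y := by
  obtain ⟨f, f1, f2, f3⟩ := h1
  refine combine_gen f f1 f2 f3 hZ ?_ h2
  intro x hx y hy z hz
  rw [mem_sdiff] at hy
  exact ⟨fun h => absurd ((hK.2 x (hK.1 hx) y hy.1 h).1 hx) hy.2,
    fun h => absurd ((hK.2 y hy.1 x (hK.1 hx) h).2 hx) hy.2⟩

theorem card_closed {A : Finset (V × V)} {X K : Finset V} (hK : Closed A X K) :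
    (res A X).card = (res A K).card + (res A (X \ K)).card := by
  rw [← card_union_of_disjoint]
  · congr 1
    ext ⟨x, y⟩
    simp only [mem_union, mem_res, mem_sdiff]
    constructor
    · rintro ⟨h, hx, hy⟩
      have := hK.2 x hx y hy h
      tauto
    · rintro (⟨h, hx, hy⟩ | ⟨h, hx, hy⟩)
      · exact ⟨h, hK.1 hx, hK.1 hy⟩
      · exact ⟨h, hx.1, hy.1⟩
  · rw [disjoint_left]
    rintro ⟨x, y⟩
    simp only [mem_res, mem_sdiff]
    tauto

theorem dt_eq (A : Finset (V × V)) (v : V) :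
    dt A v = (A.filter (fun p => p.1 = v)).card + (A.filter (fun p => p.2 = v)).card := by
  have h1 : db A true v = (A.filter (fun p => p.1 = v)).card := by
    unfold db
    rw [card_filter, ← sum_filter_add_sum_filter_not univ (fun y => (v, y) ∈ A)]
    rw [sum_congr rfl (g := fun _ => 1) (by intro y hy; simp at hy; simp [ar, hy]),
      sum_congr (s₁ := filter (fun y => ¬ (v, y) ∈ A) univ) rfl (g := fun _ => 0)
      (by intro y hy; simp at hy; simp [ar, hy])]
    simp only [sum_const_zero, add_zero, sum_const, smul_eq_mul, mul_one]
    rw [← card_filter]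
    refine card_bij (fun y _ => (v, y)) ?_ ?_ ?_
    · intro y hy; simp at hy; simp [hy]
    · intro y _ y' _ h; simpa using h
    · rintro ⟨x, y⟩ h; simp at h; exact ⟨y, by simp [← h.2, h.1], by simp [h.2]⟩
  have h2 : db A false v = (A.filter (fun p => p.2 = v)).card := by
    unfold db
    rw [card_filter, ← sum_filter_add_sum_filter_not univ (fun y => (y, v) ∈ A)]
    rw [sum_congr rfl (g := fun _ => 1) (by intro y hy; simp at hy; simp [ar, hy]),
      sum_congr (s₁ := filter (fun y => ¬ (y, v) ∈ A) univ) rfl (g := fun _ => 0)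
      (by intro y hy; simp at hy; simp [ar, hy])]
    simp only [sum_const_zero, add_zero, sum_const, smul_eq_mul, mul_one]
    rw [← card_filter]
    refine card_bij (fun y _ => (y, v)) ?_ ?_ ?_
    · intro y hy; simp at hy; simp [hy]
    · intro y _ y' _ h; simpa using h
    · rintro ⟨x, y⟩ h; simp at h; exact ⟨x, by simp [← h.2, h.1], by simp [h.2]⟩
  unfold dt
  rw [Fintype.sum_bool, h1, h2]

theorem card_res_sdiff_le {A : Finset (V × V)} (hA : Irr A) {Y Z : Finset V} {v : V} (hv : v ∈ Z) :
    (res A (Y \ Z)).card + dt (res A Y) v ≤ (res A Y).card := by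
  rw [dt_eq, ← card_union_of_disjoint, ← card_union_of_disjoint]
  · apply card_le_card
    intro p hp
    simp only [mem_union, mem_filter] at hp
    rcases hp with h | h | h
    · exact res_mono A sdiff_subset h
    · exact h.1
    · exact h.1
  · rw [disjoint_left]
    rintro ⟨x, y⟩ h1 h2
    rw [mem_res, mem_sdiff, mem_sdiff] at h1
    simp only [mem_union, mem_filter] at h2
    rcases h2 with h | h
    · exact h1.2.1.2 (h.2 ▸ hv)
    · exact h1.2.2.2 (h.2 ▸ hv)
  · rw [disjoint_left]
    rintro p h1 h2
    rw [mem_filter] at h1 h2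
    exact irr_res hA Y p h1.1 (h1.2.trans h2.2.symm)

theorem card_res_erase {A : Finset (V × V)} (hA : Irr A) {Y : Finset V} {v : V} :
    (res A (Y.erase v)).card + dt (res A Y) v = (res A Y).card := by
  refine le_antisymm ?_ ?_
  · have := card_res_sdiff_le hA (Y := Y) (mem_singleton_self v)
    rwa [sdiff_singleton_eq_erase] at this
  · rw [dt_eq]
    have : res A Y ⊆ res A (Y.erase v) ∪ ((res A Y).filter (fun p => p.1 = v) ∪
      (res A Y).filter (fun p => p.2 = v)) := by
      rintro ⟨x, y⟩ h
      simp only [mem_union, mem_filter, mem_res, mem_erase] at h ⊢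
      tauto
    refine (card_le_card this).trans ((card_union_le _ _).trans ?_)
    gcongr
    exact card_union_le _ _
end
end DP

namespace DP
open Finset
section
variable {V : Type*} [DecidableEq V] [Fintype V]

theorem Closed.trans {A : Finset (V × V)} {X K L : Finset V} (h1 : Closed A X K)
    (h2 : Closed A K L) : Closed A X L := by
  refine ⟨h2.1.trans h1.1, fun x hx y hy hxy => ?_⟩
  have := h1.2 x hx y hy hxy
  constructor
  · intro h
    have hk := h2.1 h
    exact (h2.2 x hk y (this.1 hk) hxy).1 h
  · intro h
    have hk := h2.1 h
    exact (h2.2 x (this.2 hk) y hk hxy).2 h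

theorem Closed.sdiff {A : Finset (V × V)} {X K : Finset V} (h1 : Closed A X K) :
    Closed A X (X \ K) := by
  refine ⟨sdiff_subset, fun x hx y hy hxy => ?_⟩
  have := h1.2 x hx y hy hxy
  simp [hx, hy, this]

theorem Closed.self (A : Finset (V × V)) (X : Finset V) : Closed A X X :=
  ⟨Subset.refl _, fun x hx y hy _ => by simp [hx, hy]⟩

theorem card_res_insert {A : Finset (V × V)} {S : Finset V} {x y z : V} (hxy : (x, y) ∈ A)
    (hz : z ∉ S) (h : (x = z ∧ y ∈ S) ∨ (x ∈ S ∧ y = z)) :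
    (res A S).card + 1 ≤ (res A (insert z S)).card := by
  have : insert (x, y) (res A S) ⊆ res A (insert z S) := by
    rw [insert_subset_iff]
    refine ⟨mem_res.2 ⟨hxy, ?_, ?_⟩, res_mono A (subset_insert _ _)⟩
    · rcases h with h | h <;> simp [h]
    · rcases h with h | h <;> simp [h]
  refine le_trans (le_of_eq ?_) (card_le_card this)
  rw [card_insert_of_notMem]
  rw [mem_res]
  rintro ⟨-, h1, h2⟩
  rcases h with h | h
  · exact hz (h.1 ▸ h1)
  · exact hz (h.2 ▸ h2)

theorem tree_of_min {A : Finset (V × V)} {X K : Finset V} (hK : Closed A X K)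
    (hne : K.Nonempty)
    (hmin : ∀ L, Closed A X L → L.Nonempty → (res A L).card < L.card → K.card ≤ L.card) :
    K.card ≤ (res A K).card + 1 := by
  by_contra hcon
  push Not at hcon
  obtain ⟨x0, hx0⟩ := hne
  let T := K.powerset.filter (fun S => S.Nonempty ∧ S.card ≤ (res A S).card + 1)
  have hT : T.Nonempty := ⟨{x0}, by simp [T, hx0]⟩
  obtain ⟨S, hS, hmax⟩ := exists_max_image T card hT
  simp only [T, mem_filter, mem_powerset] at hS hmax
  obtain ⟨hSK, hSne, hSc⟩ := hS
  have hSneK : S ≠ K := by rintro rfl; omega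
  have hss : S ⊂ K := hSK.ssubset_of_ne hSneK
  have hcl : Closed A K S := by
    refine ⟨hSK, fun x hx y hy hxy => ?_⟩
    by_contra hiff
    have hcase : (x ∉ S ∧ y ∈ S) ∨ (x ∈ S ∧ y ∉ S) := by tauto
    rcases hcase with ⟨h1, h2⟩ | ⟨h1, h2⟩
    · have h3 := card_res_insert hxy h1 (Or.inl ⟨rfl, h2⟩)
      have h4 := hmax (insert x S) ⟨insert_subset hx hSK, insert_nonempty _ _, by
        rw [card_insert_of_notMem h1]; omega⟩
      rw [card_insert_of_notMem h1] at h4; omega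
    · have h3 := card_res_insert hxy h2 (Or.inr ⟨h1, rfl⟩)
      have h4 := hmax (insert y S) ⟨insert_subset hy hSK, insert_nonempty _ _, by
        rw [card_insert_of_notMem h2]; omega⟩
      rw [card_insert_of_notMem h2] at h4; omega
  have h1 := card_closed hcl
  have h2 : (K \ S).card + S.card = K.card := card_sdiff_add_card_eq_card hSK
  have hS1 := hSne.card_pos
  have h4 := hmin (K \ S) (hK.trans hcl.sdiff) (by
    obtain ⟨z, hz, hz'⟩ := exists_of_ssubset hss
    exact ⟨z, mem_sdiff.2 ⟨hz, hz'⟩⟩) (by omega)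
  omega

open Classical in
theorem tree {A : Finset (V × V)} : ∀ (M : ℕ) (X : Finset V), (res A X).card + (M + 1) ≤ X.card →
    ∃ K, Closed A X K ∧ K.Nonempty ∧ (res A K).card + 1 = K.card ∧ K.card * (M + 1) ≤ X.card := by
  have main : ∀ (M : ℕ) (X : Finset V), (res A X).card + (M + 1) ≤ X.card →
    ∃ K, Closed A X K ∧ K.Nonempty ∧ (res A K).card + 1 = K.card ∧ K.card * (M + 1) ≤ X.card ∧
    (∀ L, Closed A X L → L.Nonempty → (res A L).card < L.card → K.card ≤ L.card) := by
    intro M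
    induction M with
    | zero =>
      intro X hX
      let T := X.powerset.filter (fun S => Closed A X S ∧ S.Nonempty ∧ (res A S).card < S.card)
      have hT : T.Nonempty := ⟨X, by
        simp only [T, mem_filter, mem_powerset]
        exact ⟨Subset.refl _, Closed.self A X, card_pos.1 (by omega), by omega⟩⟩
      obtain ⟨K, hK, hmin⟩ := exists_min_image T card hT
      simp only [T, mem_filter, mem_powerset] at hK hmin
      have hmin' : ∀ L, Closed A X L → L.Nonempty → (res A L).card < L.card → K.card ≤ L.card :=
        fun L h1 h2 h3 => hmin L ⟨h1.1, h1, h2, h3⟩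
      refine ⟨K, hK.2.1, hK.2.2.1, ?_, ?_, hmin'⟩
      · have := tree_of_min hK.2.1 hK.2.2.1 hmin'
        have := hK.2.2.2
        omega
      · have := card_le_card hK.1; omega
    | succ M ih =>
      intro X hX
      obtain ⟨K, h1, h2, h3, h4, h5⟩ := ih X (by omega)
      refine ⟨K, h1, h2, h3, ?_, h5⟩
      have e1 := card_closed h1
      have e2 : (X \ K).card + K.card = X.card := card_sdiff_add_card_eq_card h1.1
      obtain ⟨L, l1, l2, l3, l4, l5⟩ := ih (X \ K) (by omega)
      have := h5 L (h1.sdiff.trans l1) l2 (by omega)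
      have := Nat.mul_le_mul_right (M + 1) this
      calc K.card * (M + 1 + 1) = K.card * (M + 1) + K.card := by ring
        _ ≤ _ := by omega
  intro M X hX
  obtain ⟨K, h1, h2, h3, h4, h5⟩ := main M X hX
  exact ⟨K, h1, h2, h3, h4⟩

theorem lemmaA1 {A A' : Finset (V × V)} (hA : Irr A) (hA' : Irr A') {X Y : Finset V} {N : ℕ}
    (hX : X.card = N) (hY : Y.card = N)
    (s D0 Δ' h h' : ℕ) (hs : (res A X).card ≤ s ^ 2)
    (hD : ∀ x ∈ X, dt (res A X) x ≤ D0) (hΔ : ∀ y ∈ Y, dt (res A' Y) y ≤ Δ')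
    (hh : 2 * (res A X).card < (h + 1) * s) (hh' : 2 * (res A' Y).card < (h' + 1) * s)
    (hnum : ∀ e e', e = (res A X).card → e' = (res A' Y).card →
      2 * e * s * e' ^ 2 + e * (e * (e' * Δ')) + (N - 2) *
      (2 * e * s * e' + e * (e' * Δ') + e * (e' * (2 * s + 2)))
      + (Δ' + D0 + h + h') * (N * (N - 1) * (N - 2))
      < N * (N * (N - 1) * (N - 2))) : PackOn A A' X Y := by
  apply packOn_of_sub
  have hmk : ∀ (B : Finset (V × V)) (Z : Finset V) (k : ℕ), 2 * (res B Z).card < (k + 1) * s →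
      (univ.filter (fun x => s < dt (sub B Z) x)).card ≤ k := by
    intro B Z k hk
    have := markov (sub B Z) s
    rw [card_sub] at this
    by_contra hcon
    push Not at hcon
    have := Nat.mul_le_mul_right s (Nat.succ_le_of_lt hcon)
    rw [Nat.succ_eq_add_one] at this
    omega
  refine lemmaA0 (irr_sub hA X) (irr_sub hA' Y) (by simp [hX, hY]) s D0 Δ' h h'
    (2 * (sub A X).card * s) ?_ ?_ (hmk A X h hh) (hmk A' Y h' hh') (sum_lo_le _ _ ?_) ?_
  · intro x; rw [dt_sub]; exact hD x x.2
  · intro x; rw [dt_sub]; exact hΔ x x.2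
  · rw [card_sub]; exact hs
  · have hd : N.descFactorial 3 = N * (N - 1) * (N - 2) := by
      simp [Nat.descFactorial_succ]; ring
    rw [card_sub, card_sub]
    simp only [Fintype.card_coe, hX, hd]
    exact hnum _ _ rfl rfl

theorem lemmaA {A A' : Finset (V × V)} (hA : Irr A) (hA' : Irr A') {X Y : Finset V} {N : ℕ}
    (hX : X.card = N) (hY : Y.card = N)
    (s D0 Δ' : ℕ) (ρ : ℝ) (hs : N ≤ s ^ 2) (hN : (res A X).card + 4 ≤ N)
    (hD : ∀ x ∈ X, dt (res A X) x ≤ D0) (hΔ : ∀ y ∈ Y, dt (res A' Y) y ≤ Δ')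
    (he' : ((res A' Y).card : ℝ) ≤ ρ * N)
    (hnum : (2 * ρ ^ 2 + 6 * ρ + 2) * s + 2 * ρ + (2 * ρ + 1) * Δ' + D0 < N) : PackOn A A' X Y := by
  have hspos : 0 < s := by
    rcases Nat.eq_zero_or_pos s with h | h
    · subst h; simp at hs; omega
    · exact h
  refine lemmaA1 hA hA' hX hY s D0 Δ' (2 * (res A X).card / s) (2 * (res A' Y).card / s)
    (by omega) hD hΔ ?_ ?_ ?_
  · rw [mul_comm (_ + 1)]; exact Nat.lt_mul_div_succ _ hspos
  · rw [mul_comm (_ + 1)]; exact Nat.lt_mul_div_succ _ hspos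
  rintro e e' he rfl
  rw [← he] at hN ⊢
  generalize (res A' Y).card = e' at *
  have hρ : 0 ≤ ρ := by
    have : (0:ℝ) < N := by exact_mod_cast (by omega : 0 < N)
    have h0 : (0:ℝ) ≤ ρ * N := le_trans (Nat.cast_nonneg _) he'
    exact nonneg_of_mul_nonneg_left h0 this
  have hsR : (0:ℝ) < s := by exact_mod_cast hspos
  have hs' : (N:ℝ) ≤ s ^ 2 := by exact_mod_cast hs
  have heN : (e:ℝ) + 4 ≤ N := by exact_mod_cast hN
  have h1 : ((2 * e / s : ℕ) : ℝ) ≤ 2 * s := by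
    refine Nat.cast_div_le.trans ?_
    rw [div_le_iff₀ hsR]; push_cast; nlinarith
  have h2 : ((2 * e' / s : ℕ) : ℝ) ≤ 2 * ρ * s := by
    refine Nat.cast_div_le.trans ?_
    rw [div_le_iff₀ hsR]; push_cast; nlinarith
  have hR : (0:ℝ) ≤ e := Nat.cast_nonneg _
  have hR' : (0:ℝ) ≤ e' := Nat.cast_nonneg _
  have hRD : (0:ℝ) ≤ Δ' := Nat.cast_nonneg _
  have hNR : (0:ℝ) < N := by linarith
  set P : ℝ := N * (N - 1) * (N - 2) with hP
  have hPpos : 0 < P := by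
    rw [hP]
    have : (0:ℝ) < N - 1 := by linarith
    have : (0:ℝ) < N - 2 := by linarith
    positivity
  -- the four estimates
  have k0 : (e:ℝ) * N ≤ (N - 1) * (N - 2) := by nlinarith
  have k1 : 2 * (e:ℝ) * s * e' ^ 2 ≤ 2 * ρ ^ 2 * s * P := by
    have : (e':ℝ) ^ 2 ≤ (ρ * N) ^ 2 := by gcongr
    calc 2 * (e:ℝ) * s * e' ^ 2 ≤ 2 * e * s * (ρ * N) ^ 2 := by gcongr
      _ = 2 * ρ ^ 2 * s * N * (e * N) := by ring
      _ ≤ 2 * ρ ^ 2 * s * N * ((N - 1) * (N - 2)) := by gcongr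
      _ = _ := by rw [hP]; ring
  have k2 : (e:ℝ) * (e * (e' * Δ')) ≤ ρ * Δ' * P := by
    calc (e:ℝ) * (e * (e' * Δ')) ≤ e * (N * ((ρ * N) * Δ')) := by gcongr; linarith
      _ = ρ * Δ' * N * (e * N) := by ring
      _ ≤ ρ * Δ' * N * ((N - 1) * (N - 2)) := by gcongr
      _ = _ := by rw [hP]; ring
  have hN2 : (0:ℝ) ≤ N - 2 := by linarith
  have k3 : ∀ w : ℝ, 0 ≤ w → ((N:ℝ) - 2) * (e * (e' * w)) ≤ ρ * w * P := by
    intro w hw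
    calc ((N:ℝ) - 2) * (e * (e' * w)) ≤ ((N:ℝ) - 2) * ((N - 1) * ((ρ * N) * w)) := by
          refine mul_le_mul_of_nonneg_left ?_ hN2
          exact mul_le_mul (by linarith) (mul_le_mul_of_nonneg_right he' hw) (by positivity)
            (by linarith)
      _ = _ := by rw [hP]; ring
  have k4 := k3 (2 * s) (by positivity)
  have k5 := k3 Δ' hRD
  have k6 := k3 (2 * s + 2) (by positivity)
  have k7 : ((Δ':ℝ) + D0 + (2 * e / s : ℕ) + (2 * e' / s : ℕ)) * P
      ≤ (Δ' + D0 + 2 * s + 2 * ρ * s) * P :=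
    mul_le_mul_of_nonneg_right (by linarith) hPpos.le
  have k8 := mul_lt_mul_of_pos_right hnum hPpos
  have c1 : ((N - 1 : ℕ) : ℝ) = N - 1 := by rw [Nat.cast_sub (by omega)]; simp
  have c2 : ((N - 2 : ℕ) : ℝ) = N - 2 := by rw [Nat.cast_sub (by omega)]; simp
  have goal : 2 * (e:ℝ) * s * e' ^ 2 + e * (e * (e' * Δ')) + (N - 2) *
      (2 * e * s * e' + e * (e' * Δ') + e * (e' * (2 * s + 2)))
      + (Δ' + D0 + (2 * e / s : ℕ) + (2 * e' / s : ℕ)) * P < N * P := by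
    nlinarith
  rw [hP] at goal
  rw [← c1, ← c2] at goal
  exact_mod_cast goal
end
end DP

namespace DP
open Finset
section
variable {V : Type*} [DecidableEq V] [Fintype V]

theorem place {A A' : Finset (V × V)} {K K1 Z1 B : Finset V} (f : V → V) (hK1 : K1 ⊆ K)
    (f1 : ∀ x ∈ K1, f x ∈ Z1) (f2 : Set.InjOn f K1)
    (f3 : ∀ x ∈ K1, ∀ y ∈ K1, (x, y) ∈ A → (f x, f y) ∉ A') (hcard : Z1.card = K1.card)
    (hdis : Disjoint Z1 B)
    (hcr : ∀ x ∈ K1, ∀ y ∈ K \ K1, ∀ z ∈ B, ((x, y) ∈ A → (f x, z) ∉ A') ∧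
      ((y, x) ∈ A → (z, f x) ∉ A'))
    (h2 : PackOn A A' (K \ K1) B) :
    ∃ Z, Z1 ⊆ Z ∧ Z ⊆ Z1 ∪ B ∧ Z.card = K.card ∧ PackOn A A' K Z := by
  obtain ⟨g, g1, g2, g3⟩ := h2
  have himg : (K \ K1).image g ⊆ B := by
    intro z hz
    obtain ⟨x, hx, rfl⟩ := mem_image.1 hz
    exact g1 x hx
  have hd : Disjoint Z1 ((K \ K1).image g) := hdis.mono_right himg
  refine ⟨Z1 ∪ (K \ K1).image g, subset_union_left, union_subset_union_right himg, ?_, ?_⟩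
  · rw [card_union_of_disjoint hd, card_image_of_injOn g2, hcard, add_comm]
    exact card_sdiff_add_card_eq_card hK1
  · have hs : (Z1 ∪ (K \ K1).image g) \ Z1 = (K \ K1).image g := by
      rw [union_sdiff_left]; exact sdiff_eq_self_of_disjoint hd.symm
    refine combine_gen f f1 f2 f3 subset_union_left ?_ ?_
    · intro x hx y hy z hz
      rw [hs] at hz
      exact hcr x hx y hy z (himg hz)
    · rw [hs]
      exact ⟨g, fun x hx => mem_image_of_mem g hx, g2, g3⟩

theorem place1 {A A' : Finset (V × V)} (hA : Irr A) {K B : Finset V} {x v : V} (hx : x ∈ K)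
    (hv : v ∉ B)
    (hcr : ∀ y ∈ K, ∀ z ∈ B, ∀ c, ar A c x y = 1 → ar A' c v z = 0)
    (h2 : PackOn A A' (K.erase x) B) :
    ∃ Z, v ∈ Z ∧ Z ⊆ insert v B ∧ Z.card = K.card ∧ PackOn A A' K Z := by
  obtain ⟨Z, h1, h3, h4, h5⟩ := place (A := A) (A' := A') (K := K) (K1 := {x}) (Z1 := {v}) (B := B)
    (fun _ => v) (by simpa using hx)
    (by simp) (by simp) (by
      intro y hy z hz h
      rw [mem_singleton] at hy hz
      exact absurd (hy.trans hz.symm) (hA _ h)) (by simp) (by simpa using hv) (by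
      intro y hy w hw z hz
      rw [mem_singleton] at hy
      subst hy
      have hwK := (mem_sdiff.1 hw).1
      have c1 := hcr w hwK z hz true
      have c2 := hcr w hwK z hz false
      simp only [ar, cond_true, cond_false] at c1 c2
      constructor
      · intro h; simpa [h] using c1
      · intro h; simpa [h] using c2) (by rwa [sdiff_singleton_eq_erase])
  exact ⟨Z, by simpa using h1, by rwa [insert_eq], h4, h5⟩

/-- non-neighbours in direction `c` -/
def nn (A' : Finset (V × V)) (Y : Finset V) (v : V) (c : Bool) : Finset V :=
  (Y.erase v).filter (fun y => ar A' c v y = 0)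

theorem nn_card {A' : Finset (V × V)} (hA' : Irr A') {Y : Finset V} {v : V} (hv : v ∈ Y) (c : Bool) :
    db (res A' Y) c v + (nn A' Y v c).card + 1 = Y.card := by
  have h1 : db (res A' Y) c v = ∑ y ∈ Y.erase v, ar A' c v y := by
    unfold db
    rw [← sum_subset (subset_univ (Y.erase v))]
    · refine sum_congr rfl (fun y hy => ?_)
      rw [ar_res, if_pos ⟨hv, mem_of_mem_erase hy⟩]
    · intro y _ hy
      rw [ar_res]
      split_ifs with h
      · by_cases hyv : y = v
        · rw [hyv, ar_self hA']
        · exact absurd (mem_erase.2 ⟨hyv, h.2⟩) hy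
      · rfl
  have h2 : (nn A' Y v c).card = ∑ y ∈ Y.erase v, (1 - ar A' c v y) := by
    unfold nn
    rw [card_filter]
    refine sum_congr rfl (fun y _ => ?_)
    have := ar_le_one A' c v y
    split_ifs with h
    · rw [h]
    · omega
  rw [h1, h2, ← sum_add_distrib]
  have : ∑ y ∈ Y.erase v, (ar A' c v y + (1 - ar A' c v y)) = ∑ y ∈ Y.erase v, 1 := by
    refine sum_congr rfl (fun y _ => ?_)
    have := ar_le_one A' c v y
    omega
  rw [this, sum_const, smul_eq_mul, mul_one, card_erase_add_one hv]

theorem exists_sink {A : Finset (V × V)} {K : Finset V} (h : (res A K).card < K.card) (c : Bool) :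
    ∃ x ∈ K, db (res A K) c x = 0 := by
  by_contra hcon
  push Not at hcon
  have : ∑ x ∈ K, 1 ≤ ∑ x ∈ K, db (res A K) c x :=
    sum_le_sum (fun x hx => Nat.one_le_iff_ne_zero.2 (hcon x hx))
  have h2 : ∑ x ∈ K, db (res A K) c x ≤ ∑ x, db (res A K) c x :=
    sum_le_sum_of_subset (subset_univ _)
  rw [sum_db] at h2
  simp at this
  omega

theorem exists_low {A : Finset (V × V)} {K : Finset V} {k : ℕ}
    (h : 2 * (res A K).card < (k + 1) * K.card) : ∃ x ∈ K, dt (res A K) x ≤ k := by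
  by_contra hcon
  push Not at hcon
  have : ∑ x ∈ K, (k + 1) ≤ ∑ x ∈ K, dt (res A K) x :=
    sum_le_sum (fun x hx => Nat.succ_le_of_lt (hcon x hx))
  have h2 : ∑ x ∈ K, dt (res A K) x ≤ ∑ x, dt (res A K) x :=
    sum_le_sum_of_subset (subset_univ _)
  rw [sum_dt] at h2
  simp at this
  rw [mul_comm] at h
  nlinarith

theorem ar_zero_of_db {A : Finset (V × V)} {K : Finset V} {x y : V} {c : Bool} (hx : x ∈ K)
    (hy : y ∈ K) (h : db (res A K) c x = 0) : ar A c x y = 0 := by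
  unfold db at h
  rw [sum_eq_zero_iff] at h
  have := h y (mem_univ y)
  rwa [ar_res, if_pos ⟨hx, hy⟩] at this

theorem sink_place {A A' : Finset (V × V)} (hA : Irr A) {K Y : Finset V} {x v : V} (hv : v ∈ Y)
    (hx : x ∈ K) {c : Bool} (hs : db (res A K) (!c) x = 0)
    (h2 : PackOn A A' (K.erase x) (nn A' Y v c)) :
    ∃ Z ⊆ Y, v ∈ Z ∧ Z.card = K.card ∧ PackOn A A' K Z := by
  obtain ⟨Z, h1, h3, h4, h5⟩ := place1 hA hx (B := nn A' Y v c) (v := v) (by simp [nn]) (by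
    intro y hy z hz d hd
    have hd0 := ar_zero_of_db hx hy hs
    have : d = c := by
      by_contra hdc
      have : d = !c := by cases d <;> cases c <;> simp_all
      rw [this, hd0] at hd
      omega
    rw [this]
    exact (mem_filter.1 hz).2) h2
  refine ⟨Z, h3.trans (insert_subset hv ((filter_subset _ _).trans (erase_subset _ _))), h1, h4, h5⟩

/-- neighbourhood of a vertex inside a set -/
def nb (A' : Finset (V × V)) (Y : Finset V) (v : V) : Finset V :=
  Y.filter (fun y => (v, y) ∈ A' ∨ (y, v) ∈ A')

theorem nb_card {A' : Finset (V × V)} (Y : Finset V) (v : V) (hv : v ∈ Y) :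
    (nb A' Y v).card ≤ dt (res A' Y) v := by
  unfold nb
  rw [card_filter]
  have : dt (res A' Y) v = ∑ y, ∑ b, ar (res A' Y) b v y := by
    unfold dt db; rw [sum_comm]
  rw [this]
  refine le_trans (sum_le_sum (fun y hy => ?_)) (sum_le_sum_of_subset (subset_univ Y))
  simp only [Fintype.sum_bool, ar_res, hv, hy, and_self, if_true]
  simp only [ar, cond_true, cond_false]
  split_ifs with h h1 h2 <;> simp_all

theorem dt_le_card {A : Finset (V × V)} (hA : Irr A) (Y : Finset V) (v : V) :
    dt (res A Y) v ≤ (res A Y).card := by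
  have := card_res_sdiff_le hA (Y := Y) (mem_singleton_self v)
  omega

theorem hub_mid {A A' : Finset (V × V)} (hA : Irr A) (hA' : Irr A') {K Y : Finset V} {v : V} {t : ℕ}
    (ht : 2 ≤ t) (hK : K.card = t) (hKe : (res A K).card + 1 = t) (hv : v ∈ Y)
    (hY : 31 * t ≤ Y.card) (hE : (res A' (Y.erase v)).card ≤ 3 * t + 3)
    (ha : ∀ c, 1 ≤ (nn A' Y v c).card) :
    ∃ Z ⊆ Y, v ∈ Z ∧ Z.card = K.card ∧ PackOn A A' K Z := by
  obtain ⟨x, hx, hdx⟩ := exists_low (A := A) (K := K) (k := 1) (by omega)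
  have hYe : (Y.erase v).card + 1 = Y.card := card_erase_add_one hv
  by_cases hq : ∃ q ∈ K, ∃ c, ar A c x q = 1
  · obtain ⟨q, hq, c, hc⟩ := hq
    have hqx : q ≠ x := by
      rintro rfl
      rw [ar_self hA] at hc; omega
    obtain ⟨q', hq'⟩ := card_pos.1 (ha c)
    rw [nn, mem_filter, mem_erase] at hq'
    obtain ⟨⟨hq'v, hq'Y⟩, hq'0⟩ := hq'
    have hdxe : dt (res A K) x = ∑ p : V × Bool, ar (res A K) p.2 x p.1 := by
      rw [Fintype.sum_prod_type, sum_comm]; rfl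
    have honly : ∀ w ∈ K, ∀ d, ar A d x w = 1 → w = q ∧ d = c := by
      intro w hw d hd
      by_contra hne
      have hne' : ((w, d) : V × Bool) ≠ (q, c) := by
        intro h; exact hne (Prod.ext_iff.1 h)
      have h3 : ∑ p ∈ ({(w, d), (q, c)} : Finset (V × Bool)), ar (res A K) p.2 x p.1
          ≤ dt (res A K) x := by
        rw [hdxe]; exact sum_le_sum_of_subset (subset_univ _)
      rw [sum_pair hne'] at h3
      simp only [ar_res, hx, hw, hq, and_self, if_true, hd, hc] at h3
      omega
    let B := ((Y.erase v).erase q') \ nb A' (Y.erase v) q'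
    have hq'E : q' ∈ Y.erase v := mem_erase.2 ⟨hq'v, hq'Y⟩
    have hnb : (nb A' (Y.erase v) q').card ≤ 3 * t + 3 :=
      (nb_card _ _ hq'E).trans ((dt_le_card hA' _ _).trans hE)
    have hBc : Y.card ≤ B.card + 2 + (3 * t + 3) := by
      have h1 : ((Y.erase v).erase q').card + 1 = (Y.erase v).card := card_erase_add_one hq'E
      have h2 := le_card_sdiff (nb A' (Y.erase v) q') ((Y.erase v).erase q')
      change _ ≤ B.card at h2
      omega
    have hK2 : (K \ {x, q}).card + 2 = t := by
      have : ({x, q} : Finset V).card = 2 := card_pair hqx.symm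
      have h2 : (K \ {x, q}).card + ({x, q} : Finset V).card = K.card :=
        card_sdiff_add_card_eq_card (by
          intro z hz; simp only [mem_insert, mem_singleton] at hz; rcases hz with rfl | rfl <;> assumption)
      omega
    obtain ⟨Z, z1, z2, z3, z4⟩ := place (A := A) (A' := A') (K := K) (K1 := {x, q}) (Z1 := {v, q'})
      (B := B) (fun z => if z = x then v else q')
      (by intro z hz; simp only [mem_insert, mem_singleton] at hz; rcases hz with rfl | rfl <;> assumption)
      (by
        intro z _
        by_cases h : z = x <;> simp [h])
      (by
        intro z hz w hw hzw
        simp only [coe_insert, coe_singleton, Set.mem_insert_iff, Set.mem_singleton_iff] at hz hw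
        by_cases h : z = x <;> by_cases h' : w = x <;> simp only [h, h', if_true, if_false] at hzw
        · rw [h, h']
        · exact absurd hzw.symm hq'v
        · exact absurd hzw hq'v
        · rw [hz.resolve_left h, hw.resolve_left h'])
      (by
        intro z hz w hw hzw
        simp only [mem_insert, mem_singleton] at hz hw
        by_cases h : z = x
        · have hw' : w = q := hw.resolve_left (fun h' => hA _ hzw (h.trans h'.symm))
          subst h hw'
          have hz1 := (honly w hq true (by simp [ar, hzw])).2
          rw [← hz1] at hq'0
          simp [ar] at hq'0
          simpa [hqx] using hq'0
        · have hz' : z = q := hz.resolve_left h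
          have hw' : w = x := by
            by_contra h'
            exact hA _ hzw (hz'.trans (hw.resolve_left h').symm)
          subst hw' hz'
          have hz1 := (honly z hq false (by simp [ar, hzw])).2
          rw [← hz1] at hq'0
          simp [ar] at hq'0
          simpa [hqx] using hq'0)
      (by rw [card_pair hqx.symm, card_pair hq'v.symm])
      (by
        rw [disjoint_left]
        intro z hz hzB
        simp only [mem_insert, mem_singleton] at hz
        rw [mem_sdiff, mem_erase, mem_erase] at hzB
        rcases hz with rfl | rfl
        · exact hzB.1.2.1 rfl
        · exact hzB.1.1 rfl)
      (by
        intro z hz w hw y hy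
        simp only [mem_insert, mem_singleton] at hz
        rw [mem_sdiff] at hw
        simp only [mem_insert, mem_singleton, not_or] at hw
        rcases hz with rfl | rfl
        · constructor
          · intro h; exact absurd (honly w hw.1 true (by simp [ar, h])).1 hw.2.2
          · intro h; exact absurd (honly w hw.1 false (by simp [ar, h])).1 hw.2.2
        · simp only [hqx, if_false]
          rw [mem_sdiff, nb, mem_filter, not_and, not_or] at hy
          have := hy.2 (mem_of_mem_erase hy.1)
          exact ⟨fun _ => this.1, fun _ => this.2⟩)
      (by
        refine layer0 hA (by omega) (Or.inl ?_)
        have h1 : (res A (K \ {x, q})).card ≤ t - 1 := by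
          have := card_le_card (res_mono A (sdiff_subset : K \ {x, q} ⊆ K))
          omega
        have h2 : (res A' B).card ≤ 3 * t + 3 :=
          (card_le_card (res_mono A' (sdiff_subset.trans (erase_subset _ _)))).trans hE
        have h3 : 20 * t ≤ B.card := by omega
        calc _ ≤ (t - 1) * (3 * t + 3) := Nat.mul_le_mul h1 h2
          _ ≤ t * (6 * t) := Nat.mul_le_mul (by omega) (by omega)
          _ < (20 * t) * (19 * t) := by nlinarith
          _ ≤ _ := Nat.mul_le_mul h3 (by omega))
    refine ⟨Z, ?_, z1 (by simp), z3, z4⟩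
    refine z2.trans (union_subset ?_ (sdiff_subset.trans ((erase_subset _ _).trans (erase_subset _ _))))
    intro z hz; simp only [mem_insert, mem_singleton] at hz; rcases hz with rfl | rfl <;> assumption
  · push Not at hq
    obtain ⟨Z, h1, h3, h4, h5⟩ := place1 (A := A) (A' := A') hA hx (B := Y.erase v) (v := v) (by simp)
      (fun y hy z _ c hc => absurd hc (hq y hy c)) (by
        have h0 : (K.erase x).card + 1 = K.card := card_erase_add_one hx
        refine layer0 hA (by omega) (Or.inl ?_)
        have h1 : (res A (K.erase x)).card ≤ t - 1 := by
          have := card_le_card (res_mono A (erase_subset x K))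
          omega
        have h3 : 20 * t ≤ (Y.erase v).card := by omega
        calc _ ≤ (t - 1) * (3 * t + 3) := Nat.mul_le_mul h1 hE
          _ ≤ t * (6 * t) := Nat.mul_le_mul (by omega) (by omega)
          _ < (20 * t) * (19 * t) := by nlinarith
          _ ≤ _ := Nat.mul_le_mul h3 (by omega))
    refine ⟨Z, h3.trans ?_, h1, h4, h5⟩
    rw [insert_erase hv]

theorem hub {A A' : Finset (V × V)} (hA : Irr A) (hA' : Irr A') {K Y : Finset V} {v : V} {t : ℕ}
    (hK : K.card = t) (hKe : (res A K).card + 1 = t) (hv : v ∈ Y)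
    (hY : 31 * t ≤ Y.card) (he' : (res A' Y).card + t + 1 ≤ 2 * Y.card) :
    ∃ Z ⊆ Y, v ∈ Z ∧ Z.card = K.card ∧ PackOn A A' K Z := by
  by_cases ht1 : t = 1
  · refine ⟨{v}, by simpa using hv, by simp, by simp [hK, ht1], layer0 hA (by simp [hK, ht1]) (Or.inr ?_)⟩
    have : (res A K).card = 0 := by omega
    simp [this]
  have ht : 2 ≤ t := by omega
  have hE := card_res_erase hA' (Y := Y) (v := v)
  have hdt : dt (res A' Y) v = db (res A' Y) true v + db (res A' Y) false v := by
    unfold dt; rw [Fintype.sum_bool]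
  have ht' := nn_card hA' hv true
  have hf' := nn_card hA' hv false
  have hsum : ∀ c, (res A' (Y.erase v)).card + t ≤ (nn A' Y v c).card + (nn A' Y v (!c)).card + 1 := by
    intro c; cases c <;> simp only [Bool.not_true, Bool.not_false] <;> omega
  have hnnsub : ∀ c, (res A' (nn A' Y v c)).card ≤ (res A' (Y.erase v)).card := fun c =>
    card_le_card (res_mono A' (filter_subset _ _))
  have hsink : ∀ c, t - 1 ≤ (nn A' Y v c).card →
      ((t - 1) * (res A' (Y.erase v)).card < (nn A' Y v c).card * ((nn A' Y v c).card - 1) ∨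
      (res A' (Y.erase v)).card = 0) → ∃ Z ⊆ Y, v ∈ Z ∧ Z.card = K.card ∧ PackOn A A' K Z := by
    intro c h1 h2
    obtain ⟨x, hx, hx0⟩ := exists_sink (A := A) (K := K) (by omega) (!c)
    refine sink_place hA hv hx hx0 (layer0 hA ?_ ?_)
    · rw [card_erase_of_mem hx]; omega
    · have h3 : (res A (K.erase x)).card ≤ t - 1 := by
        have := card_le_card (res_mono A (erase_subset x K)); omega
      rcases h2 with h2 | h2
      · left
        exact lt_of_le_of_lt (Nat.mul_le_mul h3 (hnnsub c)) h2
      · right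
        have := hnnsub c
        have : (res A' (nn A' Y v c)).card = 0 := by omega
        rw [this, mul_zero]
  have hmax : ∃ c, (nn A' Y v (!c)).card ≤ (nn A' Y v c).card := by
    rcases le_total (nn A' Y v true).card (nn A' Y v false).card with h | h
    · exact ⟨false, h⟩
    · exact ⟨true, h⟩
  obtain ⟨c, hc⟩ := hmax
  have hs := hsum c
  by_cases hbig : 2 * t + 2 ≤ (nn A' Y v c).card
  · refine hsink c (by omega) (Or.inl ?_)
    generalize (nn A' Y v c).card = b at *
    generalize (nn A' Y v (!c)).card = a at *
    have h1 : (res A' (Y.erase v)).card ≤ 2 * b := by omega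
    have h2 : 2 * (t - 1) ≤ b - 4 := by omega
    calc (t - 1) * (res A' (Y.erase v)).card ≤ (t - 1) * (2 * b) := Nat.mul_le_mul_left _ h1
      _ = b * (2 * (t - 1)) := by ring
      _ ≤ b * (b - 4) := Nat.mul_le_mul_left _ h2
      _ < b * (b - 1) := by
        apply Nat.mul_lt_mul_of_pos_left <;> omega
  · by_cases h0 : (nn A' Y v (!c)).card = 0
    · rw [h0] at hs
      refine hsink c (by omega) ?_
      generalize (nn A' Y v c).card = b at *
      by_cases hb : (res A' (Y.erase v)).card = 0
      · right; exact hb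
      left
      calc (t - 1) * (res A' (Y.erase v)).card ≤ (b - 1) * (b - 1) := Nat.mul_le_mul (by omega) (by omega)
        _ < b * (b - 1) := by
          apply Nat.mul_lt_mul_of_pos_right <;> omega
    · refine hub_mid hA hA' ht hK hKe hv hY (by omega) ?_
      intro d
      rcases Bool.eq_or_eq_not d c with rfl | rfl <;> omega
end
end DP

namespace DP
open Finset
section
variable {V : Type*} [DecidableEq V] [Fintype V]

theorem dt_closed {A : Finset (V × V)} {X K : Finset V} (hK : Closed A X K) {x : V} (hx : x ∈ K) :
    dt (res A K) x = dt (res A X) x := by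
  unfold dt db
  refine sum_congr rfl (fun b _ => sum_congr rfl (fun y _ => ?_))
  rw [ar_res, ar_res]
  by_cases hy : y ∈ K
  · rw [if_pos ⟨hx, hy⟩, if_pos ⟨hK.1 hx, hK.1 hy⟩]
  · rw [if_neg (by tauto)]
    split_ifs with h
    · have : ar A b x y ≠ 1 := by
        intro h1
        cases b
        · simp [ar] at h1
          exact hy ((hK.2 y h.2 x h.1 h1).2 hx)
        · simp [ar] at h1
          exact hy ((hK.2 x h.1 y h.2 h1).1 hx)
      have := ar_le_one A b x y
      omega
    · rfl

theorem Closed.union {A : Finset (V × V)} {X K L : Finset V} (h1 : Closed A X K)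
    (h2 : Closed A X L) : Closed A X (K ∪ L) := by
  refine ⟨union_subset h1.1 h2.1, fun x hx y hy hxy => ?_⟩
  rw [mem_union, mem_union, h1.2 x hx y hy hxy, h2.2 x hx y hy hxy]

theorem trees {A : Finset (V × V)} (hA : Irr A) {X : Finset V} {M : ℕ} (hM : (res A X).card + M ≤ X.card) :
    ∀ k, k ≤ M → ∃ K P, Closed A X K ∧ P ⊆ K ∧ P.card = k ∧ (∀ x ∈ P, ∀ y ∈ P, (x, y) ∉ A) ∧
      (res A K).card + k = K.card ∧ (res A (X \ K)).card + (M - k) ≤ (X \ K).card ∧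
      X.card * (M - k) ≤ (X \ K).card * M ∧ ∀ x ∈ K, dt (res A X) x * (M + 1 - k) ≤ X.card := by
  intro k
  induction k with
  | zero =>
    intro _
    refine ⟨∅, ∅, ⟨by simp, by simp⟩, by simp, by simp, by simp, by simp [res], by simpa using hM,
      by simp, by simp⟩
  | succ k ih =>
    intro hk
    obtain ⟨K, P, h1, h2, h3, h4, h5, h6, h7, h8⟩ := ih (by omega)
    obtain ⟨j, hj⟩ : ∃ j, M - k = j + 1 := ⟨M - k - 1, by omega⟩
    rw [hj] at h6 h7
    have hj2 : M - (k + 1) = j := by omega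
    rw [hj2]
    obtain ⟨L, l1, ⟨p, hp⟩, l3, l4⟩ := tree j (X \ K) h6
    have hLX : Closed A X L := h1.sdiff.trans l1
    have hdis : Disjoint K L := by
      rw [disjoint_left]; intro x hx hx'
      exact (mem_sdiff.1 (l1.1 hx')).2 hx
    have hXKL : X \ (K ∪ L) = (X \ K) \ L := by rw [sdiff_sdiff_left]; rfl
    have c1 := card_closed l1
    have c2 : ((X \ K) \ L).card + L.card = (X \ K).card := card_sdiff_add_card_eq_card l1.1
    have hpK : p ∉ K := (mem_sdiff.1 (l1.1 hp)).2
    have hXKle : (X \ K).card ≤ X.card := card_le_card sdiff_subset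
    refine ⟨K ∪ L, insert p P, h1.union hLX, ?_, ?_, ?_, ?_, ?_, ?_, ?_⟩
    · rw [insert_subset_iff]
      exact ⟨mem_union_right _ hp, h2.trans subset_union_left⟩
    · rw [card_insert_of_notMem (fun h => hpK (h2 h)), h3]
    · have hpX : p ∈ X := hLX.1 hp
      intro x hx y hy hxy
      rw [mem_insert] at hx hy
      rcases hx with rfl | hx <;> rcases hy with rfl | hy
      · exact hA _ hxy rfl
      · exact hpK ((h1.2 _ hpX _ (h1.1 (h2 hy)) hxy).2 (h2 hy))
      · exact hpK ((h1.2 _ (h1.1 (h2 hx)) _ hpX hxy).1 (h2 hx))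
      · exact h4 x hx y hy hxy
    · have : Closed A (K ∪ L) K := ⟨subset_union_left, fun x hx y hy hxy =>
        h1.2 x ((h1.union hLX).1 hx) y ((h1.union hLX).1 hy) hxy⟩
      have c3 := card_closed this
      have : (K ∪ L) \ K = L := by
        rw [union_sdiff_left]; exact sdiff_eq_self_of_disjoint hdis.symm
      rw [this] at c3
      rw [card_union_of_disjoint hdis]
      omega
    · rw [hXKL]; omega
    · rw [hXKL]
      have h9 : (X \ K).card * j ≤ ((X \ K) \ L).card * (j + 1) := by nlinarith
      have h10 : X.card * (j + 1) * j ≤ ((X \ K) \ L).card * M * (j + 1) := by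
        calc X.card * (j + 1) * j ≤ (X \ K).card * M * j := Nat.mul_le_mul_right _ h7
          _ = M * ((X \ K).card * j) := by ring
          _ ≤ M * (((X \ K) \ L).card * (j + 1)) := Nat.mul_le_mul_left _ h9
          _ = _ := by ring
      have : X.card * (j + 1) * j = (X.card * j) * (j + 1) := by ring
      rw [this] at h10
      exact Nat.le_of_mul_le_mul_right h10 (by omega)
    · have e1 : M + 1 - (k + 1) = j + 1 := by omega
      have e2 : M + 1 - k = j + 2 := by omega
      rw [e1]
      intro x hx
      rcases mem_union.1 hx with hx | hx
      · have := h8 x hx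
        rw [e2] at this
        exact le_trans (Nat.mul_le_mul_left _ (by omega)) this
      · rw [← dt_closed hLX hx]
        have : dt (res A L) x ≤ L.card := (dt_le_card hA L x).trans (by omega)
        exact (Nat.mul_le_mul_right _ this).trans (l4.trans hXKle)

theorem fin7a {M a b N : ℕ} (hM : 24 ≤ M) (h : a + b = N) (h7 : N * (M - 4) ≤ a * M) : 6 * b ≤ N := by
  obtain ⟨j, rfl⟩ : ∃ j, M = j + 24 := ⟨M - 24, by omega⟩
  have e1 : j + 24 - 4 = j + 20 := by omega
  rw [e1] at h7
  rw [← h] at h7 ⊢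
  nlinarith

theorem fin7b {w u N c : ℕ} (h1 : 6 * w ≤ N) (h2 : 2 * u ≤ 5 * N) (g3 : 3 * N ≤ 4 * c + 20) (hN : 200 ≤ N) :
    w * u < c * (c - 1) := by
  have g4 : 12 * (w * u) ≤ 5 * (N * N) := by
    have : (6 * w) * (2 * u) ≤ N * (5 * N) := Nat.mul_le_mul h1 h2
    nlinarith
  obtain ⟨b, rfl⟩ : ∃ b, c = b + 1 := ⟨c - 1, by omega⟩
  rw [Nat.add_sub_cancel]
  nlinarith

theorem dstep {A A' : Finset (V × V)} (hA : Irr A) (hA' : Irr A') {X Y : Finset V} {N M Δ' : ℕ} {s : V}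
    (hX : X.card = N) (hY : Y.card = N) (hN : 200 ≤ N) (hM : 24 ≤ M)
    (hM2 : (res A X).card + M ≤ N) (he' : 2 * (res A' Y).card < 5 * N)
    (hΔ : ∀ y ∈ Y, dt (res A' Y) y ≤ Δ') (hΔN : 16 * Δ' ≤ N) (hs : s ∈ X)
    (hds : N + 15 ≤ 3 * dt (res A X) s) :
    ∃ X2 Y2, X2 ⊆ X ∧ Y2 ⊆ Y ∧ X2.card = Y2.card ∧ X2.card < N ∧ N * (M - 4) ≤ (X2.card + 1) * M ∧
      (res A X2).card + dt (res A X) s + (M - 4) ≤ X2.card + 1 ∧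
      (PackOn A A' X2 Y2 → PackOn A A' X Y) := by
  obtain ⟨K, P, h1, h2, h3, h4, h5, h6, h7, h8⟩ := trees hA (hX.symm ▸ hM2) 4 (by omega)
  rw [hX] at h7 h8
  have hXK : (X \ K).card + K.card = N := hX ▸ card_sdiff_add_card_eq_card h1.1
  have hsK : s ∉ K := by
    intro hsK
    have := h8 s hsK
    have h9 : dt (res A X) s * 3 ≤ dt (res A X) s * (M + 1 - 4) := Nat.mul_le_mul_left _ (by omega)
    omega
  have ht : 6 * K.card ≤ N := by
    exact fin7a hM hXK h7
  obtain ⟨y, hy, hdy⟩ := exists_low (A := A') (K := Y) (k := 4) (by omega)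
  have hnby : nb A' Y y ⊆ Y.erase y := by
    intro z hz
    rw [nb, mem_filter] at hz
    rw [mem_erase]
    refine ⟨?_, hz.1⟩
    rintro rfl
    rcases hz.2 with h | h <;> exact hA' _ h rfl
  have hYy : (Y.erase y).card + 1 = Y.card := card_erase_add_one hy
  obtain ⟨R, r1, r2, r3⟩ := exists_subsuperset_card_eq hnby
    ((nb_card Y y hy).trans hdy) (by omega)
  obtain ⟨f, f1, f2⟩ := exists_inj (X := P) (Y := R) (by omega)
  let B := (Y.erase y \ R) \ R.biUnion (nb A' Y)
  have hBY : B ⊆ Y := sdiff_subset.trans (sdiff_subset.trans (erase_subset _ _))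
  have hBc : N ≤ B.card + 5 + 4 * Δ' := by
    have b1 : (Y.erase y \ R).card + R.card = (Y.erase y).card := card_sdiff_add_card_eq_card r2
    have b2 := le_card_sdiff (R.biUnion (nb A' Y)) (Y.erase y \ R)
    change _ ≤ B.card at b2
    have b3 : (R.biUnion (nb A' Y)).card ≤ R.card * Δ' := card_biUnion_le_card_mul _ _ _ (by
      intro z hz
      have hzY := mem_of_mem_erase (r2 hz)
      exact (nb_card Y z hzY).trans (hΔ z hzY))
    rw [r3] at b1 b3
    omega
  have hKP : (K \ P).card + P.card = K.card := card_sdiff_add_card_eq_card h2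
  obtain ⟨Z, z1, z2, z3, z4⟩ := place (A := A) (A' := A') (K := K) (K1 := P) (Z1 := R) (B := B) f h2
    f1 f2 (fun x hx y hy hxy => absurd hxy (h4 x hx y hy)) (by omega)
    (by
      rw [disjoint_left]; intro z hz hzB
      exact (mem_sdiff.1 (mem_sdiff.1 hzB).1).2 hz)
    (by
      intro x hx w hw z hz
      have hzB := (mem_sdiff.1 hz).2
      have hzY := hBY hz
      have : z ∉ nb A' Y (f x) := fun h => hzB (mem_biUnion.2 ⟨f x, f1 x hx, h⟩)
      rw [nb, mem_filter, not_and, not_or] at this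
      have := this hzY
      exact ⟨fun _ => this.1, fun _ => this.2⟩)
    (by
      refine layer0 hA (by omega) (Or.inl ?_)
      have g1 : (res A (K \ P)).card ≤ K.card := by
        have := card_le_card (res_mono A (sdiff_subset : K \ P ⊆ K)); omega
      have g2 : (res A' B).card ≤ (res A' Y).card := card_le_card (res_mono A' hBY)
      have g3 : 3 * N ≤ 4 * B.card + 20 := by omega
      exact fin7b (by omega) (by omega) g3 hN)
  have hyZ : y ∉ Z := by
    intro h
    rcases mem_union.1 (z2 h) with h | h
    · exact (mem_erase.1 (r2 h)).1 rfl
    · exact (mem_erase.1 (mem_sdiff.1 (mem_sdiff.1 h).1).1).1 rfl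
  have hZY : Z ⊆ Y := z2.trans (union_subset (r2.trans (erase_subset _ _)) hBY)
  have hsX : s ∈ X \ K := mem_sdiff.2 ⟨hs, hsK⟩
  have hyY : y ∈ Y \ Z := mem_sdiff.2 ⟨hy, hyZ⟩
  have c1 : ((X \ K).erase s).card + 1 = (X \ K).card := card_erase_add_one hsX
  have c2 : ((Y \ Z).erase y).card + 1 = (Y \ Z).card := card_erase_add_one hyY
  have c3 : (Y \ Z).card + Z.card = Y.card := card_sdiff_add_card_eq_card hZY
  refine ⟨(X \ K).erase s, (Y \ Z).erase y, (erase_subset _ _).trans sdiff_subset,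
    (erase_subset _ _).trans sdiff_subset, by omega, by omega, by rwa [c1], ?_, ?_⟩
  · have := card_res_erase hA (Y := X \ K) (v := s)
    rw [dt_closed h1.sdiff hsX] at this
    omega
  · intro hpk
    refine combine h1 hZY z4 ?_
    refine combine_gen (K := {s}) (Z := {y}) (fun _ => y) (by simp) (by simp) ?_ (by simpa using hyY) ?_ ?_
    · intro a ha b hb hab
      rw [mem_singleton] at ha hb
      exact absurd (ha.trans hb.symm) (hA _ hab)
    · intro a _ w _ z hz
      have hz1 := mem_sdiff.1 (mem_sdiff.1 hz).1
      have : z ∉ nb A' Y y := fun h => hz1.2 (z1 (r1 h))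
      rw [nb, mem_filter, not_and, not_or] at this
      have := this hz1.1
      exact ⟨fun _ => this.1, fun _ => this.2⟩
    · rw [sdiff_singleton_eq_erase, sdiff_singleton_eq_erase]; exact hpk
end
end DP

namespace DP
open Finset
section
variable {V : Type*} [DecidableEq V] [Fintype V]

theorem num8 (M : ℕ) (h1 : 31 ≤ M) (h2 : M ≤ 93) : ∃ q : ℕ, ∃ D r d : ℝ, D = 31 * M - 125 ∧ 0 < q ∧ (q * q : ℝ) ≤ D ∧
    r = 31 * M * (M + 33) / (63 * D) ∧ d = 31 * (2 * M + 32) / (63 * D) ∧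
    (2 * r ^ 2 + 6 * r + 2) / q + (2 * r + 1) * d + 1 / 3 +
      ((2 * r ^ 2 + 6 * r + 2) + 2 * r + 14 / 3) / D < 1 := by
  refine ⟨Nat.sqrt (31 * M - 125), _, _, _, rfl, ?_, ?_, rfl, rfl, ?_⟩
  · exact Nat.sqrt_pos.2 (by omega)
  · have := Nat.sqrt_le (31 * M - 125)
    have h : ((31 * M - 125 : ℕ) : ℝ) = 31 * M - 125 := by
      rw [Nat.cast_sub (by omega)]; push_cast; rfl
    rw [← h]; exact_mod_cast this
  · interval_cases M <;> norm_num

theorem endA {A A' : Finset (V × V)} (hA : Irr A) (hA' : Irr A') {X Y : Finset V} {N N0 M Δ' : ℕ}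
    (h31 : 31 ≤ M) (h93 : M ≤ 93) (hX : X.card = N) (hY : Y.card = N)
    (hN0 : 31 * M ≤ N0) (hNN : N0 * (M - 4) ≤ (N + 1) * M) (he : (res A X).card + 4 ≤ N)
    (he' : 63 * (res A' Y).card ≤ (M + 33) * N0) (hΔ : ∀ y ∈ Y, dt (res A' Y) y ≤ Δ')
    (hΔN : 63 * M * Δ' ≤ (2 * M + 32) * N0) (hd : ∀ x ∈ X, 3 * dt (res A X) x < N + 15) :
    PackOn A A' X Y := by
  obtain ⟨q, D, r, d, hD, hq, hqD, hr, hdd, hlt⟩ := num8 M h31 h93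
  have hNN' : (N0 : ℝ) * (M - 4) ≤ (N + 1) * M := by
    have : ((N0 * (M - 4) : ℕ) : ℝ) ≤ ((N + 1) * M : ℕ) := by exact_mod_cast hNN
    rw [Nat.cast_mul, Nat.cast_sub (by omega)] at this
    push_cast at this; exact this
  have hM : (31 : ℝ) ≤ M := by exact_mod_cast h31
  have hN0' : (31 : ℝ) * M ≤ N0 := by exact_mod_cast hN0
  have hDpos : 0 < D := by rw [hD]; linarith
  have hND : D ≤ N := by
    have h : 31 * (M - 4 : ℝ) ≤ N + 1 := by
      have : (31 * (M - 4) : ℝ) * M ≤ (N + 1) * M := by nlinarith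
      exact le_of_mul_le_mul_right this (by linarith)
    rw [hD]; linarith
  have hN0N : (N0 : ℝ) * D ≤ 31 * M * N := by
    rw [hD] at hND ⊢
    nlinarith
  have hNpos : (0 : ℝ) < N := lt_of_lt_of_le hDpos hND
  have hr0 : 0 ≤ r := by rw [hr]; positivity
  have hd0 : 0 ≤ d := by rw [hdd]; positivity
  have heR : 63 * ((res A' Y).card : ℝ) ≤ (M + 33) * N0 := by exact_mod_cast he'
  have hΔR : 63 * M * (Δ' : ℝ) ≤ (2 * M + 32) * N0 := by exact_mod_cast hΔN
  have k1 : ((res A' Y).card : ℝ) ≤ r * N := by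
    rw [hr, div_mul_eq_mul_div, le_div_iff₀ (by positivity)]
    nlinarith
  have k2 : (Δ' : ℝ) ≤ d * N := by
    rw [hdd, div_mul_eq_mul_div, le_div_iff₀ (by positivity)]
    have : (Δ' * (63 * D) : ℝ) * M ≤ (31 * (2 * M + 32) * N) * M := by nlinarith
    exact le_of_mul_le_mul_right this (by linarith)
  have hs1 : N ≤ (Nat.sqrt N + 1) ^ 2 := by
    have := Nat.sqrt_le_add N
    nlinarith
  have hs2 : (q : ℝ) * Nat.sqrt N ≤ N := by
    have h1 : (Nat.sqrt N : ℝ) * Nat.sqrt N ≤ N := by exact_mod_cast Nat.sqrt_le N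
    have h2 : (q : ℝ) * q ≤ N := hqD.trans hND
    nlinarith [sq_nonneg ((q : ℝ) - Nat.sqrt N)]
  have hqR : (0 : ℝ) < q := by exact_mod_cast hq
  have hs3 : (Nat.sqrt N : ℝ) ≤ N / q := by rw [le_div_iff₀ hqR]; linarith
  refine lemmaA hA hA' hX hY (Nat.sqrt N + 1) ((N + 14) / 3) Δ' r hs1 he
    (fun x hx => by have := hd x hx; omega) hΔ k1 ?_
  have k3 : (((N + 14) / 3 : ℕ) : ℝ) ≤ (N + 14) / 3 := by
    have := @Nat.cast_div_le ℝ _ _ _ (N + 14) 3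
    push_cast at this; exact this
  push_cast
  generalize hC : 2 * r ^ 2 + 6 * r + 2 = C at *
  have hC0 : 0 ≤ C := by rw [← hC]; positivity
  have k4 : C * (Nat.sqrt N : ℝ) ≤ C / q * N := by
    calc C * (Nat.sqrt N : ℝ) ≤ C * (N / q) := mul_le_mul_of_nonneg_left hs3 hC0
      _ = _ := by ring
  have k5 : (2 * r + 1) * (Δ' : ℝ) ≤ (2 * r + 1) * d * N := by
    calc (2 * r + 1) * (Δ' : ℝ) ≤ (2 * r + 1) * (d * N) := mul_le_mul_of_nonneg_left k2 (by positivity)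
      _ = _ := by ring
  have k6 : C + 2 * r + 14 / 3 ≤ (C + 2 * r + 14 / 3) / D * N := by
    rw [div_mul_eq_mul_div, le_div_iff₀ hDpos]
    exact mul_le_mul_of_nonneg_left hND (by positivity)
  have k7 := mul_lt_mul_of_pos_right hlt hNpos
  linarith

theorem fin8 {a b x : ℕ} (f1 : 3 * a ≤ x) (f3 : 20 * b ≤ 43 * (x + 14)) (f4 : 500 ≤ x) :
    a * b < x * (x - 1) := by
  obtain ⟨i, rfl⟩ : ∃ i, x = i + 500 := ⟨x - 500, by omega⟩
  have : i + 500 - 1 = i + 499 := by omega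
  rw [this]
  have := Nat.mul_le_mul f1 f3
  nlinarith

theorem fin8b {M2 N2 x : ℕ} (h3M : N2 + 50 ≤ 3 * M2) (d3 : N2 * (M2 - 4) ≤ (x + 1) * M2) (d2 : x < N2) :
    N2 ≤ x + 13 := by
  obtain ⟨i, rfl⟩ : ∃ i, M2 = i + 4 := ⟨M2 - 4, by omega⟩
  rw [Nat.add_sub_cancel] at d3
  by_contra hcc
  have h := Nat.mul_le_mul_right i (show x + 14 ≤ N2 by omega)
  nlinarith

theorem fin8c {j N N2 e : ℕ} (hj : j ≤ 62) (he' : 63 * e ≤ (j + 31 + 33) * N)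
    (c3 : N * (j + 27) ≤ (N2 + 1) * (j + 31)) : 20 * e ≤ 43 * (N2 + 1) := by
  have g1 : 20 * ((j + 64) * (j + 31)) ≤ 43 * 63 * (j + 27) := by
    have : j ≤ 62 := by omega
    nlinarith
  by_contra hcc
  push Not at hcc
  have g2 : 63 * e * (j + 27) ≤ (j + 64) * ((N2 + 1) * (j + 31)) := by
    calc 63 * e * (j + 27) ≤ (j + 31 + 33) * N * (j + 27) := Nat.mul_le_mul_right _ he'
      _ = (j + 64) * (N * (j + 27)) := by ring
      _ ≤ _ := Nat.mul_le_mul_left _ c3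
  have g3 := Nat.mul_le_mul_right (N2 + 1) g1
  have g4 := Nat.mul_lt_mul_of_pos_right hcc (show 0 < 63 * (j + 27) by omega)
  nlinarith

theorem fin8d {j N N2 : ℕ} (c3 : N * (j + 27) ≤ (N2 + 1) * (j + 31)) (h : N2 < N) :
    27 * N ≤ 31 * (N2 + 1) := by
  by_contra hcc
  push Not at hcc
  nlinarith

theorem fin8e {j N D : ℕ} (h : 63 * (j + 31) * D ≤ (2 * (j + 31) + 32) * N) :
    31 * 63 * D ≤ 94 * N := by
  by_contra hcc
  push Not at hcc
  nlinarith

theorem dhub {A A' : Finset (V × V)} (hA : Irr A) (hA' : Irr A') {X Y : Finset V} {N M : ℕ}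
    (h31 : 31 ≤ M) (h93 : M ≤ 93) (hX : X.card = N) (hY : Y.card = N)
    (hN : 31 * M ≤ N) (he : (res A X).card + M ≤ N)
    (he' : 63 * (res A' Y).card ≤ (M + 33) * N)
    (hd' : ∀ y ∈ Y, 63 * M * dt (res A' Y) y < (2 * M + 32) * N) :
    PackOn A A' X Y := by
  obtain ⟨Δ', hΔ'⟩ : ∃ Δ', Δ' = (2 * M + 32) * N / (63 * M) := ⟨_, rfl⟩
  have hΔ : ∀ y ∈ Y, dt (res A' Y) y ≤ Δ' := by
    intro y hy
    rw [hΔ', Nat.le_div_iff_mul_le (by omega)]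
    have := hd' y hy
    nlinarith
  have hΔN : 63 * M * Δ' ≤ (2 * M + 32) * N := by rw [hΔ']; exact Nat.mul_div_le _ _
  clear hΔ' hd'
  by_cases hc : ∀ x ∈ X, 3 * dt (res A X) x < N + 15
  · exact endA hA hA' h31 h93 hX hY hN (by nlinarith [Nat.sub_le M 4]) (by omega) he' hΔ hΔN hc
  push Not at hc
  obtain ⟨s, hs, hds⟩ := hc
  obtain ⟨j, rfl⟩ : ∃ j, M = j + 31 := ⟨M - 31, by omega⟩
  have e4 : j + 31 - 4 = j + 27 := by omega
  have hΔ31 : 31 * 63 * Δ' ≤ 94 * N := fin8e hΔN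
  have he2 : (res A' Y).card ≤ 2 * N := by nlinarith
  obtain ⟨X2, Y2, x1, y1, c1, c2, c3, c4, c5⟩ := dstep hA hA' hX hY (by omega) (by omega) he
    (by omega) hΔ (by omega) hs hds
  rw [e4] at c3 c4
  apply c5
  have hY2 : (res A' Y2).card ≤ (res A' Y).card := card_le_card (res_mono A' y1)
  have hΔ2 : ∀ y ∈ Y2, dt (res A' Y2) y ≤ Δ' := fun y hy =>
    (dt_mono (res_mono A' y1) y).trans (hΔ y (y1 hy))
  obtain ⟨N2, hN2⟩ : ∃ N2, N2 = X2.card := ⟨_, rfl⟩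
  rw [← hN2] at c1 c2 c3 c4
  have hr : 27 * N ≤ 31 * (N2 + 1) := fin8d c3 c2
  by_cases hc : ∀ x ∈ X2, 3 * dt (res A X2) x < N2 + 15
  · exact endA hA hA' h31 h93 hN2.symm c1.symm hN (by rw [e4]; exact c3) (by omega)
      (by omega) hΔ2 hΔN hc
  push Not at hc
  obtain ⟨s2, hs2, hds2⟩ := hc
  have h20 : 20 * (res A' Y).card ≤ 43 * (N2 + 1) := by
    exact fin8c (by omega) he' c3
  obtain ⟨M2, hM2⟩ : ∃ M2, M2 = N2 - (res A X2).card := ⟨_, rfl⟩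
  have h3M : N2 + 50 ≤ 3 * M2 := by omega
  obtain ⟨X3, Y3, x2, y2, d1, d2, d3, d4, d5⟩ := dstep hA hA' (M := M2) (Δ' := Δ') hN2.symm c1.symm
    (by omega) (by omega) (by omega) (by omega) hΔ2 (by omega) hs2 hds2
  apply d5
  have hY3 : (res A' Y3).card ≤ (res A' Y2).card := card_le_card (res_mono A' y2)
  refine layer0 hA d1.le (Or.inl ?_)
  have f1 : 3 * (res A X3).card ≤ X3.card := by omega
  have f2 : N2 ≤ X3.card + 13 := by
    exact fin8b h3M d3 d2
  rw [← d1]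
  have f3 : 20 * (res A' Y3).card ≤ 43 * (X3.card + 14) := by omega
  have f4 : 500 ≤ X3.card := by omega
  exact fin8 f1 f3 f4
end
end DP

namespace DP
open Finset
section
variable {V : Type*} [DecidableEq V] [Fintype V]

theorem fin9a {j N t N2 : ℕ} (h : N2 + t = N) (ht : t * (j + 1) ≤ N) (hN : 31 * (j + 1) ≤ N) : 31 * j ≤ N2 := by
  subst h
  have h1 : t * j ≤ N2 := by nlinarith
  by_contra hcc
  push Not at hcc
  have : t < 31 := by
    by_contra h2
    push Not at h2
    nlinarith
  nlinarith

theorem fin9b {j N t N2 e e2 d : ℕ} (h : N2 + t = N) (ht : t * (j + 1) ≤ N)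
    (he : 63 * e ≤ (j + 1 + 33) * N) (hd : (2 * (j + 1) + 32) * N ≤ 63 * (j + 1) * d)
    (h2 : e2 + d ≤ e) : 63 * e2 ≤ (j + 33) * N2 := by
  subst h
  have h1 : t * j ≤ N2 := by nlinarith
  have g1 := Nat.mul_le_mul_right (j + 1) he
  have g2 := Nat.mul_le_mul_right (63 * (j + 1)) h2
  have g3 := Nat.mul_le_mul_right (j + 33) h1
  have : (63 * e2) * (j + 1) ≤ ((j + 33) * N2) * (j + 1) := by nlinarith
  exact Nat.le_of_mul_le_mul_right this (by omega)

theorem fin9c {M N e t : ℕ} (h1 : 30 ≤ M) (h2 : M ≤ 92) (hN : 31 * M ≤ N)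
    (he : 63 * e ≤ (M + 33) * N) (ht : t * M ≤ N) : e + t + 1 ≤ 2 * N := by
  have g : 92 ≤ (93 - M) * M := by
    obtain ⟨i, hi⟩ : ∃ i, 93 = M + i + 1 := ⟨92 - M, by omega⟩
    have : 93 - M = i + 1 := by omega
    rw [this]; nlinarith
  have g1 := Nat.mul_le_mul_right M he
  have g2 := Nat.mul_le_mul_right N g
  obtain ⟨i, hi⟩ : ∃ i, i = 93 - M := ⟨_, rfl⟩
  rw [← hi] at g2
  have hi2 : (M + 33) * N * M + i * M * N = 126 * N * M := by
    have : 126 = M + 33 + i := by omega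
    rw [this]; ring
  have : (63 * (e + t + 1)) * M ≤ (126 * N) * M := by nlinarith
  have := Nat.le_of_mul_le_mul_right this (by omega)
  omega

theorem mainRec {A A' : Finset (V × V)} (hA : Irr A) (hA' : Irr A') : ∀ k, k ≤ 63 → ∀ (M' : ℕ) (X Y : Finset V) (N : ℕ),
    k + 30 ≤ M' → X.card = N → Y.card = N → 31 * (k + 30) ≤ N → (res A X).card + M' ≤ N →
    63 * (res A' Y).card ≤ (k + 30 + 33) * N → (∀ t, t * M' ≤ N → (res A' Y).card + t + 1 ≤ 2 * N) →
    PackOn A A' X Y := by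
  intro k
  induction k with
  | zero =>
    intro _ M' X Y N hM hX hY hN he he' _
    refine layer0 hA (by omega) (Or.inl ?_)
    rw [hY]
    have h1 : (res A X).card * (res A' Y).card ≤ (N - 30) * N := Nat.mul_le_mul (by omega) (by omega)
    refine lt_of_le_of_lt h1 ?_
    rw [mul_comm]
    exact Nat.mul_lt_mul_of_pos_left (by omega) (by omega)
  | succ k ih =>
    intro hk M' X Y N hM hX hY hN he he' hh
    by_cases hc : ∀ y ∈ Y, 63 * (k + 1 + 30) * dt (res A' Y) y < (2 * (k + 1 + 30) + 32) * N
    · exact dhub hA hA' (by omega) (by omega) hX hY hN (by omega) he' hc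
    push Not at hc
    obtain ⟨v, hv, hdv⟩ := hc
    obtain ⟨M1, rfl⟩ : ∃ M1, M' = M1 + 1 := ⟨M' - 1, by omega⟩
    obtain ⟨K, k1, -, k3, k4⟩ := tree M1 X (hX.symm ▸ he)
    rw [hX] at k4
    have k5 : K.card * (k + 30 + 1) ≤ N := le_trans (Nat.mul_le_mul_left _ (by omega)) k4
    have k6 : 31 * K.card ≤ N := le_trans (by nlinarith) k5
    obtain ⟨Z, z1, z2, z3, z4⟩ := hub hA hA' rfl k3 hv (by omega) (by rw [hY]; exact hh _ k4)
    have c1 : (X \ K).card + K.card = X.card := card_sdiff_add_card_eq_card k1.1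
    have c2 : (Y \ Z).card + Z.card = Y.card := card_sdiff_add_card_eq_card z1
    have c3 := card_closed k1
    have c4 := card_res_sdiff_le hA' (Y := Y) z2
    have e1 : k + 1 + 30 = k + 30 + 1 := by omega
    rw [e1] at hdv he' hN
    have hN2 : 31 * (k + 30) ≤ (X \ K).card := fin9a (c1.trans hX) k5 hN
    have he2 : 63 * (res A' (Y \ Z)).card ≤ (k + 30 + 33) * (X \ K).card :=
      fin9b (c1.trans hX) k5 he' hdv c4
    refine combine k1 z1 z4 (ih (by omega) (k + 30) _ _ (X \ K).card le_rfl rfl (by omega) hN2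
      (by omega) he2 ?_)
    intro t ht
    exact fin9c (by omega) (by omega) hN2 he2 ht

end
end DP

/-- For `m ≥ 93` and `n ≥ 31 m`, any digraph with at most `n - m` arcs packs
with any digraph with at most `2n - ⌊n/m⌋ - 1` arcs. -/
theorem packs_of_card_le (m n : ℕ) (hm : 93 ≤ m) (hn : 31 * m ≤ n)
    (A A' : Finset (Fin n × Fin n)) (hA : IsDigraph A) (hA' : IsDigraph A')
    (hcardA : A.card ≤ n - m) (hcardA' : A'.card ≤ 2 * n - n / m - 1) :
    Packs A A' := by
  have hAi : DP.Irr A := hA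
  have hA'i : DP.Irr A' := hA'
  have r1 : DP.res A Finset.univ = A := by ext ⟨x, y⟩; simp [DP.mem_res]
  have r2 : DP.res A' Finset.univ = A' := by ext ⟨x, y⟩; simp [DP.mem_res]
  have hq : n / m ≤ n := Nat.div_le_self _ _
  have hq2 : n / m ≤ n / 93 := Nat.div_le_div_left hm (by norm_num)
  obtain ⟨f, -, h2, h3⟩ := DP.mainRec hAi hA'i 63 le_rfl m Finset.univ Finset.univ n (by omega) (by simp)
    (by simp) (by omega) (by rw [r1]; omega) (by rw [r2]; clear hq2; generalize n / m = z at *; omega) (by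
      intro t ht
      rw [r2]
      have := (Nat.le_div_iff_mul_le (by omega)).2 ht
      omega)
  have hinj : Function.Injective f := fun x y h => h2 (by simp) (by simp) h
  refine ⟨Equiv.ofBijective f (Finite.injective_iff_bijective.1 hinj), ?_⟩
  rintro ⟨x, y⟩ hp
  exact h3 x (by simp) y (by simp) hp
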